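/- Assume the limits ω₋ and ω₊ of q at −∞ and +∞ exist in (−∞,+∞], and that there exists u₀ ∈ ℝ such that 0 ≤ q(u₀) < min{ω₋,ω₊} and ā·min{ω₋,ω₊} > ‖a‖_∞·q(u₀) + ‖e⁻‖_∞, where e⁻ denotes the negative part of e. Then there exists s₀ ∈ (−∞, ā·ω₋) such that: for s < s₀, equation (WE_s) has no T-periodic solutions; for s = s₀, it has at least one T-periodic solution; for s₀ < s < ā·ω₋, it has at least one T-periodic solution; and for s₀ < s < ā·min{ω₋,ω₊}, it has at least two T-periodic solutions. -/

import Mathlib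

open MeasureTheory Set Filter

noncomputable section

/-- The Lebesgue measure restricted to the interval `[0,T]`. -/
def muT (T : ℝ) : Measure ℝ := volume.restrict (Icc 0 T)

/-- `u` is a `C¹` function on `[0,T]` with derivative `u'` there, satisfying the
`T`-periodic boundary conditions `u 0 = u T` and `u' 0 = u' T`. -/
def IsC1Periodic (T : ℝ) (u u' : ℝ → ℝ) : Prop :=
  (∀ t ∈ Icc (0:ℝ) T, HasDerivWithinAt u (u' t) (Icc (0:ℝ) T) t) ∧
    ContinuousOn u' (Icc (0:ℝ) T) ∧ u 0 = u T ∧ u' 0 = u' T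

/-- `φ ∘ u'` is absolutely continuous on `[0,T]`, being the indefinite integral of the
integrable function `w` (which is then its a.e. derivative). -/
def IsACPhiDeriv (T : ℝ) (φ : ℝ → ℝ) (u' w : ℝ → ℝ) : Prop :=
  IntegrableOn w (Icc (0:ℝ) T) ∧
    ∀ t ∈ Icc (0:ℝ) T, φ (u' t) = φ (u' 0) + ∫ τ in (0:ℝ)..t, w τ

/-- `u` is a `T`-periodic solution of `(φ(u'))' + f(u)u' + a(t) q(u) = s + e(t)`. -/
def IsSolWE (T : ℝ) (φ f q a e : ℝ → ℝ) (s : ℝ) (u : ℝ → ℝ) : Prop :=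
  ∃ u' w : ℝ → ℝ, IsC1Periodic T u u' ∧ IsACPhiDeriv T φ u' w ∧
    ∀ᵐ t ∂(muT T), w t + f (u t) * u' t + a t * q (u t) = s + e t

theorem det_one_add_eq_sum_lagrange {n : ℕ} (v : Fin (n + 1) → ℝ) (hv : Function.Injective v) :
    ∃ w : Fin (n + 1) → ℝ, ∑ i, w i = 1 ∧
      ∀ A : EuclideanSpace ℝ (Fin n) →L[ℝ] EuclideanSpace ℝ (Fin n),
        (1 + A).det = ∑ i, w i * (1 + v i • A).det := by
  have key : ∀ p : Polynomial ℝ, p.degree < (Finset.univ : Finset (Fin (n + 1))).card →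
      p.eval 1 = ∑ i, (Lagrange.basis Finset.univ v i).eval 1 * p.eval (v i) := by
    intro p hp
    have h := Lagrange.eq_interpolate (s := Finset.univ) (v := v) hv.injOn hp
    conv_lhs => rw [h]
    rw [Lagrange.interpolate_apply, Polynomial.eval_finsetSum]
    exact Finset.sum_congr rfl fun i _ => by simp [mul_comm]
  refine ⟨fun i => (Lagrange.basis Finset.univ v i).eval 1, ?_, fun A => ?_⟩
  · have := key 1 (by
      rw [Polynomial.degree_one, Finset.card_univ, Fintype.card_fin]
      exact_mod_cast Nat.succ_pos n)
    simpa using this.symm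
  · let b := (EuclideanSpace.basisFun (Fin n) ℝ).toBasis
    let M := LinearMap.toMatrix b b (A : EuclideanSpace ℝ (Fin n) →ₗ[ℝ] EuclideanSpace ℝ (Fin n))
    let p : Polynomial ℝ :=
      Matrix.det ((Polynomial.X : Polynomial ℝ) • M.map Polynomial.C + (1 : Matrix (Fin n) (Fin n) ℝ).map Polynomial.C)
    have hdet : ∀ t : ℝ, (1 + t • A).det = p.eval t := by
      intro t
      have h1 : (1 + t • A).det = Matrix.det (1 + t • M) := by
        rw [ContinuousLinearMap.det, ← LinearMap.det_toMatrix b]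
        congr 1
        have : ((1 + t • A : EuclideanSpace ℝ (Fin n) →L[ℝ] EuclideanSpace ℝ (Fin n)) :
          EuclideanSpace ℝ (Fin n) →ₗ[ℝ] EuclideanSpace ℝ (Fin n)) = 1 + t • (A : EuclideanSpace ℝ (Fin n) →ₗ[ℝ] EuclideanSpace ℝ (Fin n)) := rfl
        rw [this, map_add, map_smul, LinearMap.toMatrix_one]
      rw [h1, ← Polynomial.coe_evalRingHom, RingHom.map_det]
      congr 1
      ext i j
      simp [Matrix.one_apply]
      by_cases hij : i = j <;> simp [hij] <;> ring
    have hdeg : p.degree < (Finset.univ : Finset (Fin (n + 1))).card := by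
      refine lt_of_le_of_lt Polynomial.degree_le_natDegree ?_
      have := Polynomial.natDegree_det_X_add_C_le M 1
      simp only [Fintype.card_fin] at this
      simp only [Finset.card_univ, Fintype.card_fin]
      exact_mod_cast Nat.lt_succ_of_le this
    have h1 := key p hdeg
    rw [← hdet 1, one_smul] at h1
    rw [h1]
    exact Finset.sum_congr rfl fun i _ => by rw [hdet]

theorem det_eq_zero_of_norm_const {n : ℕ} {r : EuclideanSpace ℝ (Fin n) → EuclideanSpace ℝ (Fin n)}
    {c : ℝ} (hc : c ≠ 0) (hr : ∀ x, ‖r x‖ = c) {r' : EuclideanSpace ℝ (Fin n) →L[ℝ] EuclideanSpace ℝ (Fin n)}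
    {x : EuclideanSpace ℝ (Fin n)} (h : HasFDerivAt r r' x) : r'.det = 0 := by
  by_contra hdet
  have hsurj : Function.Surjective r' := by
    have hu : IsUnit (LinearMap.det (r' : EuclideanSpace ℝ (Fin n) →ₗ[ℝ] EuclideanSpace ℝ (Fin n))) :=
      isUnit_iff_ne_zero.2 hdet
    have := (LinearMap.equivOfIsUnitDet hu).surjective
    intro y
    obtain ⟨z, hz⟩ := this y
    exact ⟨z, by simpa using hz⟩
  obtain ⟨v, hv⟩ := hsurj (r x)
  have h1 := h.norm_sq
  have h2 : (fun y => ‖r y‖ ^ 2) = fun _ => c ^ 2 := by ext y; rw [hr]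
  rw [h2] at h1
  have h3 := h1.unique (hasFDerivAt_const _ _)
  have h4 := congrArg (fun L => L v) h3
  simp [hv, hr, hc] at h4

theorem lipschitzWith_indicator_closedBall {E : Type*} [NormedAddCommGroup E] [NormedSpace ℝ E]
    {g : E → E} {R : ℝ} {K : NNReal} (hg : LipschitzOnWith K g (Metric.closedBall 0 R))
    (h0 : ∀ x, ‖x‖ = R → g x = 0) :
    LipschitzWith K ((Metric.closedBall (0 : E) R).indicator g) := by
  classical
  have mixed : ∀ x y : E, x ∈ Metric.closedBall (0 : E) R → y ∉ Metric.closedBall (0 : E) R →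
      dist (g x) 0 ≤ K * dist x y := by
    intro x y hx hy
    simp only [Metric.mem_closedBall, dist_zero_right, not_le] at hx hy
    have hcont : ContinuousOn (fun t : ℝ => ‖AffineMap.lineMap x y t‖) (Icc 0 1) := by
      have : Continuous (fun t : ℝ => (AffineMap.lineMap x y t : E)) := AffineMap.lineMap_continuous
      fun_prop
    obtain ⟨t, ht, hxt⟩ := intermediate_value_Icc zero_le_one hcont
      (show R ∈ _ from ⟨by simpa using hx, by simpa using hy.le⟩)
    simp only at hxt
    set z : E := AffineMap.lineMap x y t
    calc dist (g x) 0 = dist (g x) (g z) := by rw [h0 z hxt]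
      _ ≤ K * dist x z := hg.dist_le_mul x (by simpa using hx) z (by simp [hxt])
      _ ≤ K * dist x y := by
        gcongr
        rw [dist_left_lineMap, Real.norm_of_nonneg ht.1]
        exact mul_le_of_le_one_left dist_nonneg ht.2
  refine LipschitzWith.of_dist_le_mul fun x y => ?_
  by_cases hx : x ∈ Metric.closedBall (0 : E) R <;> by_cases hy : y ∈ Metric.closedBall (0 : E) R
  · simp only [indicator_of_mem hx, indicator_of_mem hy]; exact hg.dist_le_mul x hx y hy
  · simp only [indicator_of_mem hx, indicator_of_notMem hy]; exact mixed x y hx hy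
  · simp only [indicator_of_notMem hx, indicator_of_mem hy]
    rw [dist_comm, dist_comm x y]; exact mixed y x hy hx
  · simp only [indicator_of_notMem hx, indicator_of_notMem hy, dist_self]; positivity

/-- A perturbation of the identity with small Lipschitz constant that is the identity outside a
ball maps this ball bijectively onto itself. -/
theorem bijOn_closedBall_id_add {E : Type*} [NormedAddCommGroup E] [NormedSpace ℝ E]
    [CompleteSpace E] {g : E → E} {R : ℝ} {K : NNReal} (hK : K < 1) (hg : LipschitzWith K g)
    (h0 : ∀ x, x ∉ Metric.closedBall (0 : E) R → g x = 0) :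
    BijOn (fun x => x + g x) (Metric.closedBall 0 R) (Metric.closedBall 0 R) := by
  have happ : ApproximatesLinearOn (fun x => x + g x)
      ((ContinuousLinearEquiv.refl ℝ E : E ≃L[ℝ] E) : E →L[ℝ] E) univ K := by
    intro x _ y _
    have := hg.dist_le_mul x y
    rw [dist_eq_norm, dist_eq_norm] at this
    change ‖(x + g x) - (y + g y) - (x - y)‖ ≤ _
    rwa [show (x + g x) - (y + g y) - (x - y) = g x - g y by abel]
  have hc : Subsingleton E ∨
      K < ‖((ContinuousLinearEquiv.refl ℝ E).symm : E →L[ℝ] E)‖₊⁻¹ := by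
    rcases subsingleton_or_nontrivial E with h | h
    · exact Or.inl h
    · right
      have : ‖((ContinuousLinearEquiv.refl ℝ E).symm : E →L[ℝ] E)‖₊ = 1 := by
        ext; exact ContinuousLinearMap.norm_id
      rw [this]; simpa using hK
  have hinj : Function.Injective (fun x => x + g x) := injOn_univ.1 (happ.injOn hc)
  have hsurj : Function.Surjective (fun x => x + g x) := happ.surjective hc
  refine ⟨fun x hx => ?_, hinj.injOn, fun y hy => ?_⟩
  · by_contra hx'
    have : (fun x => x + g x) (x + g x) = (fun x => x + g x) x := by
      simp only [h0 _ hx', add_zero]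
    exact hx' (by change x + g x ∈ _; rw [hinj this]; exact hx)
  · obtain ⟨x, hx⟩ := hsurj y
    refine ⟨x, ?_, hx⟩
    by_contra hx'
    simp only [h0 _ hx', add_zero] at hx
    exact hx' (hx ▸ hy)

/-- There is no `C¹` retraction of a ball onto its boundary sphere. -/
theorem not_contDiff_retraction_sphere {n : ℕ} {R : ℝ} (hR : 0 < R)
    {r : EuclideanSpace ℝ (Fin n) → EuclideanSpace ℝ (Fin n)} (hr : ContDiff ℝ 1 r)
    (hnorm : ∀ x, ‖r x‖ = R) (hid : ∀ x, ‖x‖ = R → r x = x) : False := by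
  set B : Set (EuclideanSpace ℝ (Fin n)) := Metric.closedBall 0 R with hB
  have hBc : IsCompact B := isCompact_closedBall 0 R
  set g : EuclideanSpace ℝ (Fin n) → EuclideanSpace ℝ (Fin n) := fun x => r x - x with hgdef
  have hg : ContDiff ℝ 1 g := hr.sub contDiff_id
  obtain ⟨K, hK⟩ : ∃ K, LipschitzOnWith K g B :=
    (hg.locallyLipschitz.locallyLipschitzOn).exists_lipschitzOnWith_of_compact hBc
  set A : EuclideanSpace ℝ (Fin n) → EuclideanSpace ℝ (Fin n) →L[ℝ] EuclideanSpace ℝ (Fin n) :=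
    fun x => fderiv ℝ g x with hA
  have hAc : Continuous A := hg.continuous_fderiv one_ne_zero
  have hgd : ∀ x, HasFDerivAt g (A x) x := fun x =>
    (hg.differentiable one_ne_zero x).hasFDerivAt
  obtain ⟨δ, hδ, hdet⟩ : ∃ δ > 0, ∀ t : ℝ, 0 ≤ t → t < δ → ∀ x ∈ B, 0 < (1 + t • A x).det := by
    have hcont : Continuous
        (fun M : EuclideanSpace ℝ (Fin n) →L[ℝ] EuclideanSpace ℝ (Fin n) => (1 + M).det) :=
      ContinuousLinearMap.continuous_det.comp (continuous_const.add continuous_id)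
    have hev : ∀ᶠ M in nhds (0 : EuclideanSpace ℝ (Fin n) →L[ℝ] EuclideanSpace ℝ (Fin n)),
        0 < (1 + M).det := by
      refine hcont.continuousAt.eventually_const_lt ?_
      simp [ContinuousLinearMap.det]
    obtain ⟨η, hη, hball⟩ := Metric.eventually_nhds_iff.1 hev
    obtain ⟨C, hC⟩ := hBc.exists_bound_of_continuousOn hAc.continuousOn
    refine ⟨η / (|C| + 1), by positivity, fun t ht0 ht x hx => hball ?_⟩
    rw [dist_zero_right, norm_smul, Real.norm_of_nonneg ht0]
    have h1 : ‖A x‖ ≤ |C| + 1 := (hC x hx).trans ((le_abs_self C).trans (by linarith))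
    have h2 : t * (|C| + 1) < η := (lt_div_iff₀ (by positivity)).1 ht
    nlinarith [norm_nonneg (A x)]
  have hvol : ∀ t : ℝ, 0 ≤ t → t < δ → t * K < 1 →
      ∫ x in B, (1 + t • A x).det = (volume B).toReal := by
    intro t ht0 htδ htK
    have hbij : BijOn (fun x => x + B.indicator (fun x => t • g x) x) B B := by
      refine bijOn_closedBall_id_add (K := Real.toNNReal t * K) ?_ ?_ ?_
      · rw [← NNReal.coe_lt_coe]; simpa [ht0] using htK
      · refine lipschitzWith_indicator_closedBall ?_ ?_
        · refine LipschitzOnWith.of_dist_le_mul fun x hx y hy => ?_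
          rw [dist_smul₀, Real.norm_of_nonneg ht0, NNReal.coe_mul, Real.coe_toNNReal t ht0, mul_assoc]
          exact mul_le_mul_of_nonneg_left (hK.dist_le_mul x hx y hy) ht0
        · intro x hx
          simp [hgdef, hid x hx]
      · intro x hx
        exact indicator_of_notMem hx _
    have hbij' : BijOn (fun x => x + t • g x) B B :=
      hbij.congr fun x hx => by simp [indicator_of_mem hx]
    have hlin := lintegral_abs_det_fderiv_eq_addHaar_image volume hBc.measurableSet
      (f := fun x => x + t • g x) (f' := fun x => 1 + t • A x)
      (fun x _ => ((hasFDerivAt_id x).add ((hgd x).const_smul t)).hasFDerivWithinAt) hbij'.injOn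
    rw [hbij'.image_eq] at hlin
    rw [← hlin, integral_eq_lintegral_of_nonneg_ae]
    · congr 1
      refine setLIntegral_congr_fun hBc.measurableSet fun x hx => ?_
      simp only [abs_of_pos (hdet t ht0 htδ x hx)]
    · filter_upwards [ae_restrict_mem hBc.measurableSet] with x hx
      exact (hdet t ht0 htδ x hx).le
    · exact (ContinuousLinearMap.continuous_det.comp
        (continuous_const.add (hAc.const_smul t))).aestronglyMeasurable
  obtain ⟨τ, hτ, hτδ, hτK⟩ : ∃ τ > 0, τ < δ ∧ τ * K < 1 := by
    refine ⟨min (δ / 2) (1 / (K + 1) / 2), by positivity, ?_, ?_⟩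
    · exact (min_le_left _ _).trans_lt (by linarith)
    · have h1 : min (δ / 2) (1 / ((K : ℝ) + 1) / 2) ≤ 1 / (K + 1) / 2 := min_le_right _ _
      calc _ ≤ 1 / ((K : ℝ) + 1) / 2 * K := by gcongr
        _ < 1 := by
          have : (0 : ℝ) ≤ K := K.2
          rw [div_div, div_mul_eq_mul_div, div_lt_one (by positivity)]
          linarith
  set v : Fin (n + 1) → ℝ := fun i => τ * (i : ℝ) / (n + 1) with hv
  have hv0 : ∀ i, 0 ≤ v i := fun i => by positivity
  have hvτ : ∀ i, v i ≤ τ := fun i => by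
    have : (i : ℝ) ≤ n + 1 := by exact_mod_cast i.2.le
    rw [hv]; simp only
    rw [div_le_iff₀ (by positivity)]
    gcongr
  have hvinj : Function.Injective v := by
    intro i j hij
    have hn : (n : ℝ) + 1 ≠ 0 := by positivity
    simp only [hv] at hij
    rw [div_left_inj' hn, mul_right_inj' hτ.ne'] at hij
    exact Fin.ext (by exact_mod_cast hij)
  obtain ⟨w, hw1, hw⟩ := det_one_add_eq_sum_lagrange v hvinj
  have hintg : ∫ x in B, (1 + A x).det = (volume B).toReal := by
    rw [integral_congr_ae (ae_of_all _ fun x => hw (A x)), integral_finsetSum]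
    · simp_rw [integral_const_mul]
      rw [← one_mul (volume B).toReal, ← hw1, Finset.sum_mul]
      refine Finset.sum_congr rfl fun i _ => ?_
      rw [hvol (v i) (hv0 i) ((hvτ i).trans_lt hτδ)
        ((mul_le_mul_of_nonneg_right (hvτ i) K.2).trans_lt hτK)]
    · intro i _
      refine Integrable.const_mul ?_ _
      exact ((ContinuousLinearMap.continuous_det.comp
        (continuous_const.add (hAc.const_smul (v i)))).continuousOn).integrableOn_compact hBc
  have hzero : ∀ x, (1 + A x).det = 0 := by
    intro x
    refine det_eq_zero_of_norm_const hR.ne' hnorm (x := x) ?_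
    have := (hasFDerivAt_id x).add (hgd x)
    refine this.congr_of_eventuallyEq (Eventually.of_forall fun y => ?_)
    simp [hgdef]
  simp_rw [hzero] at hintg
  simp only [integral_zero] at hintg
  have hpos : 0 < volume B := Metric.measure_closedBall_pos volume 0 hR
  exact (ENNReal.toReal_pos hpos.ne' hBc.measure_lt_top.ne).ne hintg

/-- **Brouwer's fixed point theorem**, for bounded maps of Euclidean space. -/
theorem exists_fixedPoint_of_norm_le_one {n : ℕ}
    {f : EuclideanSpace ℝ (Fin n) → EuclideanSpace ℝ (Fin n)} (hf : Continuous f)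
    (hf1 : ∀ x, ‖f x‖ ≤ 1) : ∃ x, f x = x := by
  by_contra! hne
  set l : EuclideanSpace ℝ (Fin n) → ℝ := fun x => max 0 (min 1 (2 - ‖x‖)) with hl
  have hlc : Continuous l := by fun_prop
  have hl1 : ∀ x, ‖l x‖ ≤ 1 := fun x => by
    rw [Real.norm_of_nonneg (le_max_left _ _)]
    exact max_le zero_le_one (min_le_left _ _)
  set ρ : EuclideanSpace ℝ (Fin n) → EuclideanSpace ℝ (Fin n) := fun x => x - l x • f x with hρ
  have hρ0 : ∀ x, ρ x ≠ 0 := by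
    intro x hx
    have hx' : x = l x • f x := sub_eq_zero.1 hx
    have hxn : ‖x‖ ≤ 1 := by
      rw [hx', norm_smul]
      exact mul_le_one₀ (hl1 x) (norm_nonneg _) (hf1 x)
    have : l x = 1 := by
      simp only [hl]
      rw [min_eq_left (by linarith), max_eq_right zero_le_one]
    rw [this, one_smul] at hx'
    exact hne x hx'.symm
  obtain ⟨w, hw, hwε, hwsupp⟩ := (hlc.smul hf).exists_contDiff_approx 1
    (ε := fun x => ‖ρ x‖) (by fun_prop) (fun x => norm_pos_iff.2 (hρ0 x))
  have hw0 : ∀ x, x - w x ≠ 0 := by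
    intro x hx
    have := hwε x
    rw [← sub_eq_zero.1 hx, dist_eq_norm] at this
    exact lt_irrefl _ this
  have hwid : ∀ x, ‖x‖ = 2 → w x = 0 := by
    intro x hx
    by_contra h
    exact hwsupp h (by simp [hl, hx])
  have hsub : ContDiff ℝ 1 (fun x => x - w x) := contDiff_id.sub hw
  refine not_contDiff_retraction_sphere (n := n) two_pos
    (r := fun x => (2 / ‖x - w x‖) • (x - w x)) ?_ ?_ ?_
  · exact (contDiff_const.div (hsub.norm ℝ hw0) fun x => norm_ne_zero_iff.2 (hw0 x)).smul hsub
  · intro x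
    have := norm_ne_zero_iff.2 (hw0 x)
    rw [norm_smul, norm_div, norm_norm, div_mul_cancel₀ _ this]
    simp
  · intro x hx
    simp [hwid x hx, hx]

theorem exists_approx_fixedPoint {E : Type*} [NormedAddCommGroup E] [NormedSpace ℝ E] {K : Set E}
    (hconv : Convex ℝ K) (hK : IsCompact K) (hne : K.Nonempty) {Φ : E → E}
    (hΦ : ContinuousOn Φ K) (hmaps : MapsTo Φ K K) {ε : ℝ} (hε : 0 < ε) :
    ∃ x ∈ K, dist (Φ x) x ≤ ε := by
  obtain ⟨p₀, hp₀⟩ := hne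
  obtain ⟨t, htK, htfin, hcover⟩ := hK.finite_cover_balls hε
  obtain ⟨N, p, -, hpt⟩ := htfin.fin_param
  have hpK : ∀ i, p i ∈ K := fun i => htK (hpt ▸ mem_range_self i)
  let S : EuclideanSpace ℝ (Fin N) → ℝ := fun x => max 1 (∑ j, max (x j) 0)
  have hS1 : ∀ x, 1 ≤ S x := fun x => le_max_left _ _
  have hS0 : ∀ x, 0 < S x := fun x => zero_lt_one.trans_le (hS1 x)
  have hSc : Continuous S := by fun_prop
  let c : EuclideanSpace ℝ (Fin N) → Fin N → ℝ := fun x i => max (x i) 0 / S x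
  have hc0 : ∀ x i, 0 ≤ c x i := fun x i => div_nonneg (le_max_right _ _) (hS0 x).le
  have hcsum : ∀ x, ∑ i, c x i ≤ 1 := fun x => by
    simp only [c]
    rw [← Finset.sum_div, div_le_one (hS0 x)]
    exact le_max_right _ _
  have hcc : ∀ i, Continuous fun x => c x i := fun i =>
    Continuous.div (by fun_prop) hSc fun x => (hS0 x).ne'
  let X : EuclideanSpace ℝ (Fin N) → E := fun x => (1 - ∑ i, c x i) • p₀ + ∑ i, c x i • p i
  have hXc : Continuous X := by fun_prop
  have hXK : ∀ x, X x ∈ K := by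
    intro x
    have := hconv.sum_mem (t := Finset.univ)
      (w := fun o : Option (Fin N) => o.elim (1 - ∑ i, c x i) (c x))
      (z := fun o : Option (Fin N) => o.elim p₀ p) ?_ ?_ ?_
    · simpa [X, Fintype.sum_option] using this
    · rintro (_ | i) _
      · simpa using hcsum x
      · exact hc0 x i
    · simp [Fintype.sum_option]
    · rintro (_ | i) _
      · exact hp₀
      · exact hpK i
  let m : EuclideanSpace ℝ (Fin N) → Fin N → ℝ := fun x i => max 0 (ε - dist (Φ (X x)) (p i))
  have hm0 : ∀ x i, 0 ≤ m x i := fun x i => le_max_left _ _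
  have hΦX : Continuous fun x => Φ (X x) := hΦ.comp_continuous hXc hXK
  have hmc : ∀ i, Continuous fun x => m x i := fun i =>
    continuous_const.max (continuous_const.sub (hΦX.dist continuous_const))
  have hmpos : ∀ x, 0 < ∑ i, m x i := by
    intro x
    obtain ⟨y, hy, hyb⟩ := mem_iUnion₂.1 (hcover (hmaps (hXK x)))
    obtain ⟨i, rfl⟩ : y ∈ range p := hpt ▸ hy
    refine Finset.sum_pos' (fun i _ => hm0 x i) ⟨i, Finset.mem_univ _, ?_⟩
    exact lt_max_of_lt_right (sub_pos.2 (Metric.mem_ball.1 hyb))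
  let W : EuclideanSpace ℝ (Fin N) → EuclideanSpace ℝ (Fin N) :=
    fun x => WithLp.toLp 2 fun i => m x i / ∑ j, m x j
  have hWc : Continuous W := by
    refine (PiLp.continuous_toLp 2 _).comp (continuous_pi fun i => ?_)
    exact (hmc i).div (continuous_finsetSum _ fun j _ => hmc j) fun x => (hmpos x).ne'
  have hW0 : ∀ x i, 0 ≤ W x i := fun x i => div_nonneg (hm0 x i) (hmpos x).le
  have hWsum : ∀ x, ∑ i, W x i = 1 := fun x => by
    simp only [W]
    rw [← Finset.sum_div, div_self (hmpos x).ne']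
  have hWle : ∀ x i, W x i ≤ 1 := fun x i => by
    rw [← hWsum x]
    exact Finset.single_le_sum (fun i _ => hW0 x i) (Finset.mem_univ i)
  have hW1 : ∀ x, ‖W x‖ ≤ 1 := by
    intro x
    rw [EuclideanSpace.norm_eq, Real.sqrt_le_one, ← hWsum x]
    refine Finset.sum_le_sum fun i _ => ?_
    rw [Real.norm_of_nonneg (hW0 x i)]
    nlinarith [hW0 x i, hWle x i]
  obtain ⟨x, hx⟩ := exists_fixedPoint_of_norm_le_one hWc hW1
  have hx0 : ∀ i, 0 ≤ x i := fun i => hx ▸ hW0 x i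
  have hxsum : ∑ i, x i = 1 := by
    have := hWsum x
    rwa [hx] at this
  have hcx : ∀ i, c x i = x i := by
    intro i
    simp only [c, S]
    simp_rw [max_eq_left (hx0 _)]
    rw [hxsum, max_self, div_one]
  have hXx : X x = ∑ i, x i • p i := by
    simp only [X, hcx, hxsum, sub_self, zero_smul, zero_add]
  refine ⟨X x, hXK x, ?_⟩
  rw [dist_eq_norm]
  calc ‖Φ (X x) - X x‖ = ‖∑ i, x i • (Φ (X x) - p i)‖ := by
        simp_rw [smul_sub]
        rw [Finset.sum_sub_distrib, ← Finset.sum_smul, hxsum, one_smul, ← hXx]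
    _ ≤ ∑ i, x i * ε := by
        refine norm_sum_le_of_le _ fun i _ => ?_
        rw [norm_smul, Real.norm_of_nonneg (hx0 i)]
        rcases le_or_gt (dist (Φ (X x)) (p i)) ε with h | h
        · rw [dist_eq_norm] at h
          exact mul_le_mul_of_nonneg_left h (hx0 i)
        · have : x i = 0 := by
            rw [← hx]
            simp only [W]
            have : m x i = 0 := max_eq_left (by linarith)
            rw [this, zero_div]
          simp [this]
    _ = ε := by rw [← Finset.sum_mul, hxsum, one_mul]

/-- **Schauder's fixed point theorem** for compact convex sets. -/
theorem exists_fixedPoint_of_isCompact_convex {E : Type*} [NormedAddCommGroup E] [NormedSpace ℝ E]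
    {K : Set E} (hconv : Convex ℝ K) (hK : IsCompact K) (hne : K.Nonempty) {Φ : E → E}
    (hΦ : ContinuousOn Φ K) (hmaps : MapsTo Φ K K) : ∃ x ∈ K, Φ x = x := by
  obtain ⟨x, hx, hmin⟩ := hK.exists_isMinOn hne (continuous_dist.comp_continuousOn (hΦ.prodMk continuousOn_id))
  refine ⟨x, hx, dist_le_zero.1 (le_of_forall_pos_le_add fun ε hε => ?_)⟩
  obtain ⟨y, hy, hyε⟩ := exists_approx_fixedPoint hconv hK hne hΦ hmaps hε
  exact (hmin hy).trans (by simpa using hyε)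

/-- The functions on `[0,T]` that are bounded by `B` and Lipschitz with constant `Λ`. -/
def lipschitzBall (T Λ B : ℝ) : Set C(Icc (0 : ℝ) T, ℝ) :=
  {u | (∀ t, |u t| ≤ B) ∧ ∀ t t', |u t - u t'| ≤ Λ * |(t : ℝ) - t'|}

theorem convex_lipschitzBall (T Λ B : ℝ) : Convex ℝ (lipschitzBall T Λ B) := by
  intro u hu v hv p r hp hr hpr
  refine ⟨fun t => ?_, fun t t' => ?_⟩
  · simp only [ContinuousMap.add_apply, ContinuousMap.smul_apply, smul_eq_mul]
    calc |p * u t + r * v t| ≤ p * |u t| + r * |v t| := by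
          refine (abs_add_le _ _).trans ?_
          rw [abs_mul, abs_mul, abs_of_nonneg hp, abs_of_nonneg hr]
      _ ≤ p * B + r * B := by gcongr; exacts [hu.1 t, hv.1 t]
      _ = B := by rw [← add_mul, hpr, one_mul]
  · simp only [ContinuousMap.add_apply, ContinuousMap.smul_apply, smul_eq_mul]
    calc |p * u t + r * v t - (p * u t' + r * v t')|
        = |p * (u t - u t') + r * (v t - v t')| := by ring_nf
      _ ≤ p * |u t - u t'| + r * |v t - v t'| := by
          refine (abs_add_le _ _).trans ?_
          rw [abs_mul, abs_mul, abs_of_nonneg hp, abs_of_nonneg hr]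
      _ ≤ p * (Λ * |(t : ℝ) - t'|) + r * (Λ * |(t : ℝ) - t'|) := by
          gcongr; exacts [hu.2 t t', hv.2 t t']
      _ = Λ * |(t : ℝ) - t'| := by rw [← add_mul, hpr, one_mul]

theorem isClosed_lipschitzBall (T Λ B : ℝ) : IsClosed (lipschitzBall T Λ B) := by
  have hev : ∀ t, Continuous fun u : C(Icc (0 : ℝ) T, ℝ) => u t := fun t =>
    continuous_eval_const t
  refine IsClosed.inter ?_ ?_
  · change IsClosed {u : C(Icc (0 : ℝ) T, ℝ) | ∀ t, |u t| ≤ B}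
    simp only [ofPred_forall]
    exact isClosed_iInter fun t => isClosed_le (hev t).abs continuous_const
  · change IsClosed {u : C(Icc (0 : ℝ) T, ℝ) | ∀ t t', |u t - u t'| ≤ Λ * |(t : ℝ) - t'|}
    simp only [ofPred_forall]
    exact isClosed_iInter fun t => isClosed_iInter fun t' =>
      isClosed_le ((hev t).sub (hev t')).abs continuous_const

theorem isCompact_lipschitzBall (T Λ B : ℝ) : IsCompact (lipschitzBall T Λ B) := by
  let φ := ContinuousMap.isometryEquivBoundedOfCompact (Icc (0 : ℝ) T) ℝ
  have h : IsCompact (φ '' lipschitzBall T Λ B) := by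
    refine BoundedContinuousFunction.arzela_ascoli₂ (Icc (-B) B) isCompact_Icc _ ?_ ?_ ?_
    · exact φ.toHomeomorph.isClosedMap _ (isClosed_lipschitzBall T Λ B)
    · rintro _ t ⟨u, hu, rfl⟩
      exact abs_le.1 (hu.1 t)
    · have : UniformEquicontinuous
          ((↑) : (φ '' lipschitzBall T Λ B) → Icc (0 : ℝ) T → ℝ) := by
        refine Metric.uniformEquicontinuous_of_continuity_modulus (fun x => Λ * x) ?_ _ ?_
        · have : Continuous fun x : ℝ => Λ * x := by fun_prop
          simpa using this.tendsto 0
        · rintro t t' ⟨_, u, hu, rfl⟩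
          exact hu.2 t t'
      exact this.equicontinuous
  exact (φ.toHomeomorph.isCompact_image).1 h

theorem exists_continuous_max {X : Type*} [TopologicalSpace X] [CompactSpace X] [Nonempty X] :
    ∃ S : C(X, ℝ) → ℝ, Continuous S ∧ ∀ g, (∀ t, g t ≤ S g) ∧ ∃ t, g t = S g := by
  have hmax : ∀ g : C(X, ℝ), ∃ t, ∀ t', g t' ≤ g t := fun g => by
    obtain ⟨t, -, ht⟩ := isCompact_univ.exists_isMaxOn univ_nonempty g.continuous.continuousOn
    exact ⟨t, fun t' => ht (mem_univ t')⟩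
  choose τ hτ using hmax
  refine ⟨fun g => g (τ g), ?_, fun g => ⟨hτ g, τ g, rfl⟩⟩
  refine (LipschitzWith.of_le_add fun g h => ?_).continuous (K := 1)
  have h1 := ContinuousMap.dist_apply_le_dist (f := g) (g := h) (τ g)
  have h2 := (abs_le.1 ((Real.dist_eq _ _) ▸ h1)).2
  have h3 := hτ h (τ g)
  linarith

theorem exists_integralCLM {T : ℝ} (hT : 0 ≤ T) {w : ℝ → ℝ} (hw : Measurable w) {W : ℝ}
    (hW : ∀ t, |w t| ≤ W) :
    ∃ J : C(Icc (0 : ℝ) T, ℝ) →L[ℝ] C(Icc (0 : ℝ) T, ℝ),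
      ∀ g t, J g t = ∫ τ in (0 : ℝ)..t, w τ * IccExtend hT g τ := by
  have hbound : ∀ (g : C(Icc (0 : ℝ) T, ℝ)) τ, ‖w τ * IccExtend hT g τ‖ ≤ W * ‖g‖ := by
    intro g τ
    rw [norm_mul]
    exact mul_le_mul (hW τ) (g.norm_coe_le_norm _) (norm_nonneg _) ((abs_nonneg _).trans (hW τ))
  have hext : ∀ g : C(Icc (0 : ℝ) T, ℝ), Continuous (IccExtend hT g) := fun g =>
    g.continuous.Icc_extend'
  have hintg : ∀ (g : C(Icc (0 : ℝ) T, ℝ)) x y,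
      IntervalIntegrable (fun τ => w τ * IccExtend hT g τ) volume x y := by
    intro g x y
    refine (intervalIntegrable_const (c := W * ‖g‖)).mono_fun
      (hw.mul (hext g).measurable).aestronglyMeasurable (ae_of_all _ fun τ => ?_)
    exact (hbound g τ).trans (le_abs_self _)
  refine ⟨LinearMap.mkContinuous
    { toFun := fun g => ⟨fun t => ∫ τ in (0 : ℝ)..t, w τ * IccExtend hT g τ, ?_⟩
      map_add' := ?_
      map_smul' := ?_ } (W * T) ?_, fun g t => rfl⟩
  · exact (intervalIntegral.continuous_primitive (hintg g) 0).comp continuous_subtype_val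
  · intro g h
    ext t
    simp only [ContinuousMap.coe_mk, ContinuousMap.add_apply]
    rw [← intervalIntegral.integral_add (hintg g _ _) (hintg h _ _)]
    simp [IccExtend, mul_add]
  · intro c g
    ext t
    simp only [ContinuousMap.coe_mk, ContinuousMap.smul_apply, RingHom.id_apply, smul_eq_mul]
    rw [← intervalIntegral.integral_const_mul]
    simp [IccExtend, mul_left_comm]
  · intro g
    have hW0 : 0 ≤ W := (abs_nonneg _).trans (hW 0)
    refine (ContinuousMap.norm_le _ (by positivity)).2 fun t => ?_
    refine (intervalIntegral.norm_integral_le_of_norm_le_const fun τ _ => hbound g τ).trans ?_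
    rw [sub_zero, abs_of_nonneg t.2.1]
    calc W * ‖g‖ * (t : ℝ) ≤ W * ‖g‖ * T := by gcongr; exact t.2.2
      _ = W * T * ‖g‖ := by ring

/-- Standing assumptions on the (everywhere bounded) coefficients `a` and `e`. -/
structure BoundedCoeff (T : ℝ) (a e : ℝ → ℝ) (A E : ℝ) : Prop where
  pos : 0 < T
  meas_a : Measurable a
  meas_e : Measurable e
  a_nonneg : ∀ t, 0 ≤ a t
  a_le : ∀ t, a t ≤ A
  abs_e_le : ∀ t, |e t| ≤ E
  integral_e : ∫ t in (0 : ℝ)..T, e t = 0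

/-- `(u, y)` is a `T`-periodic solution of the planar system
`u' = ψ(y - G(u))`, `y' = σ + e(t) - a(t) Q(u)`. -/
structure IsLienardSol (T : ℝ) (ψ a e Q G : ℝ → ℝ) (σ : ℝ) (u y : ℝ → ℝ) : Prop where
  hasDeriv : ∀ t ∈ Icc (0 : ℝ) T, HasDerivWithinAt u (ψ (y t - G (u t))) (Icc (0 : ℝ) T) t
  y_eq : ∀ t ∈ Icc (0 : ℝ) T, y t = y 0 + ∫ τ in (0 : ℝ)..t, (σ + e τ - a τ * Q (u τ))
  u_per : u 0 = u T
  y_per : y 0 = y T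

namespace BoundedCoeff

variable {T A E : ℝ} {a e : ℝ → ℝ}

theorem intervalIntegrable_e (hD : BoundedCoeff T a e A E) (x y : ℝ) :
    IntervalIntegrable e volume x y :=
  (intervalIntegrable_const (c := E)).mono_fun hD.meas_e.aestronglyMeasurable
    (ae_of_all _ fun τ => (hD.abs_e_le τ).trans (le_abs_self _))

theorem intervalIntegrable_mul (hD : BoundedCoeff T a e A E) {g : ℝ → ℝ}
    (hg : ContinuousOn g (Icc 0 T)) {x y : ℝ} (hx : x ∈ Icc 0 T) (hy : y ∈ Icc 0 T) :
    IntervalIntegrable (fun τ => a τ * g τ) volume x y := by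
  have hsub : uIcc x y ⊆ Icc 0 T := uIcc_subset_Icc hx hy
  have ha : IntervalIntegrable a volume x y :=
    (intervalIntegrable_const (c := A)).mono_fun hD.meas_a.aestronglyMeasurable
      (ae_of_all _ fun τ => by
        change ‖a τ‖ ≤ ‖A‖
        rw [Real.norm_of_nonneg (hD.a_nonneg τ)]; exact (hD.a_le τ).trans (le_abs_self _))
  exact ha.mul_continuousOn (hg.mono hsub)

theorem intervalIntegrable_rhs (hD : BoundedCoeff T a e A E) {g : ℝ → ℝ} (σ : ℝ)
    (hg : ContinuousOn g (Icc 0 T)) {x y : ℝ} (hx : x ∈ Icc 0 T) (hy : y ∈ Icc 0 T) :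
    IntervalIntegrable (fun τ => σ + e τ - a τ * g τ) volume x y :=
  (intervalIntegrable_const.add (hD.intervalIntegrable_e x y)).sub
    (hD.intervalIntegrable_mul hg hx hy)

theorem integral_rhs (hD : BoundedCoeff T a e A E) {g : ℝ → ℝ} (σ : ℝ)
    (hg : ContinuousOn g (Icc 0 T)) {x y : ℝ} (hx : x ∈ Icc 0 T) (hy : y ∈ Icc 0 T) :
    ∫ τ in x..y, (σ + e τ - a τ * g τ) =
      σ * (y - x) + (∫ τ in x..y, e τ) - ∫ τ in x..y, a τ * g τ := by
  rw [intervalIntegral.integral_sub (intervalIntegrable_const.add (hD.intervalIntegrable_e x y))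
    (hD.intervalIntegrable_mul hg hx hy), intervalIntegral.integral_add intervalIntegrable_const
    (hD.intervalIntegrable_e x y)]
  simp [mul_comm]

end BoundedCoeff

theorem IsLienardSol.continuousOn {T σ : ℝ} {ψ a e Q G u y : ℝ → ℝ}
    (h : IsLienardSol T ψ a e Q G σ u y) : ContinuousOn u (Icc 0 T) :=
  fun t ht => (h.hasDeriv t ht).continuousWithinAt

theorem IsLienardSol.integral_mul_eq {T A E σ : ℝ} {ψ a e Q G u y : ℝ → ℝ}
    (hD : BoundedCoeff T a e A E) (hQ : Continuous Q) (h : IsLienardSol T ψ a e Q G σ u y) :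
    ∫ τ in (0 : ℝ)..T, a τ * Q (u τ) = σ * T := by
  have h0 : (0 : ℝ) ∈ Icc 0 T := left_mem_Icc.2 hD.pos.le
  have h1 : T ∈ Icc 0 T := right_mem_Icc.2 hD.pos.le
  have := h.y_eq T h1
  rw [hD.integral_rhs (g := fun τ => Q (u τ)) σ (hQ.comp_continuousOn h.continuousOn) h0 h1,
    hD.integral_e, h.y_per] at this
  linarith

theorem IsLienardSol.continuousOn_y {T A E σ : ℝ} {ψ a e Q G u y : ℝ → ℝ}
    (hD : BoundedCoeff T a e A E) (hQ : Continuous Q) (h : IsLienardSol T ψ a e Q G σ u y) :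
    ContinuousOn y (Icc 0 T) := by
  have h0 : (0 : ℝ) ∈ Icc 0 T := left_mem_Icc.2 hD.pos.le
  have h1 : T ∈ Icc 0 T := right_mem_Icc.2 hD.pos.le
  have hintg := hD.intervalIntegrable_rhs σ (hQ.comp_continuousOn h.continuousOn) h0 h1
  have := intervalIntegral.continuousOn_primitive_interval' hintg left_mem_uIcc
  rw [uIcc_of_le hD.pos.le] at this
  exact (continuousOn_const.add this).congr h.y_eq

/-- The continuous map `u ↦ (∫₀ᵗ (σ(u) + e - a Q(u)) - G(u))`, where `σ(u)` is the mean value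
of `a Q(u)`. -/
theorem exists_lienardOperator {T A E : ℝ} {a e Q G : ℝ → ℝ} (hD : BoundedCoeff T a e A E)
    (hQ : Continuous Q) (hG : Continuous G) {M N : ℝ} (hM : ∀ x, |Q x| ≤ M)
    (hN : ∀ x, |G x| ≤ N) :
    ∃ (σ : C(Icc (0 : ℝ) T, ℝ) → ℝ) (r : C(Icc (0 : ℝ) T, ℝ) → C(Icc (0 : ℝ) T, ℝ)) (Y : ℝ),
      Continuous σ ∧ Continuous r ∧
      (∀ u : C(Icc (0 : ℝ) T, ℝ), ∫ τ in (0 : ℝ)..T, a τ * Q (IccExtend hD.pos.le u τ) = σ u * T) ∧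
      (∀ u t, r u t = (∫ τ in (0 : ℝ)..t, (σ u + e τ - a τ * Q (IccExtend hD.pos.le u τ)))
        - G (u t)) ∧
      ∀ u t, |r u t| < Y := by
  have hT := hD.pos
  have hA : ∀ t, |a t| ≤ A := fun t => by rw [abs_of_nonneg (hD.a_nonneg t)]; exact hD.a_le t
  obtain ⟨Ja, hJa⟩ := exists_integralCLM hT.le hD.meas_a hA
  obtain ⟨Je, hJe⟩ := exists_integralCLM hT.le hD.meas_e hD.abs_e_le
  let Qc : C(ℝ, ℝ) := ⟨Q, hQ⟩
  let Gc : C(ℝ, ℝ) := ⟨G, hG⟩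
  let ι : C(Icc (0 : ℝ) T, ℝ) := ⟨fun t => t, continuous_subtype_val⟩
  let top : Icc (0 : ℝ) T := ⟨T, right_mem_Icc.2 hT.le⟩
  let σ : C(Icc (0 : ℝ) T, ℝ) → ℝ := fun u => Ja (Qc.comp u) top / T
  have hQc : Continuous fun u : C(Icc (0 : ℝ) T, ℝ) => Qc.comp u := Qc.continuous_postcomp
  have hGc : Continuous fun u : C(Icc (0 : ℝ) T, ℝ) => Gc.comp u := Gc.continuous_postcomp
  have hσc : Continuous σ :=
    ((continuous_eval_const top).comp (Ja.continuous.comp hQc)).div_const T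
  let r : C(Icc (0 : ℝ) T, ℝ) → C(Icc (0 : ℝ) T, ℝ) := fun u =>
    σ u • ι + Je 1 - Ja (Qc.comp u) - Gc.comp u
  have hrc : Continuous r :=
    (((hσc.smul continuous_const).add continuous_const).sub (Ja.continuous.comp hQc)).sub hGc
  have hJaQ : ∀ u t, Ja (Qc.comp u) t = ∫ τ in (0 : ℝ)..t, a τ * Q (IccExtend hT.le u τ) :=
    fun u t => hJa _ t
  have hJe1 : ∀ t, Je 1 t = ∫ τ in (0 : ℝ)..t, e τ := fun t => by
    rw [hJe]; simp [IccExtend]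
  have hM0 : 0 ≤ M := (abs_nonneg _).trans (hM 0)
  have hA0 : 0 ≤ A := (hD.a_nonneg 0).trans (hD.a_le 0)
  have hE0 : 0 ≤ E := (abs_nonneg _).trans (hD.abs_e_le 0)
  have hJab : ∀ u t, |Ja (Qc.comp u) t| ≤ A * M * T := by
    intro u t
    rw [hJaQ, ← Real.norm_eq_abs]
    refine (intervalIntegral.norm_integral_le_of_norm_le_const (C := A * M) fun τ _ => ?_).trans ?_
    · rw [norm_mul]
      exact mul_le_mul (hA τ) (hM _) (norm_nonneg _) hA0
    · rw [sub_zero, abs_of_nonneg t.2.1]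
      gcongr; exact t.2.2
  have hJeb : ∀ t, |Je 1 t| ≤ E * T := by
    intro t
    rw [hJe1, ← Real.norm_eq_abs]
    refine (intervalIntegral.norm_integral_le_of_norm_le_const fun τ _ => hD.abs_e_le τ).trans ?_
    rw [sub_zero, abs_of_nonneg t.2.1]
    gcongr; exact t.2.2
  refine ⟨σ, r, A * M * T + E * T + A * M * T + N + 1, hσc, hrc, fun u => ?_, fun u t => ?_,
    fun u t => ?_⟩
  · rw [div_mul_cancel₀ _ hT.ne', hJaQ]
  · have hcont : Continuous fun τ => Q (IccExtend hT.le u τ) := hQ.comp u.continuous.Icc_extend'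
    rw [hD.integral_rhs (g := fun τ => Q (IccExtend hT.le u τ)) (σ u) hcont.continuousOn
      (left_mem_Icc.2 hT.le) t.2, ← hJaQ, ← hJe1]
    simp [r, ι, Gc]
  · have h1 : |σ u * (t : ℝ)| ≤ A * M * T := by
      have h2 : |σ u * T| ≤ A * M * T := by rw [div_mul_cancel₀ _ hT.ne']; exact hJab u top
      refine le_trans ?_ h2
      rw [abs_mul, abs_mul, abs_of_nonneg t.2.1, abs_of_pos hT]
      gcongr; exact t.2.2
    have h3 := hJab u t
    have h4 := hJeb t
    have h5 := hN (u t)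
    have : r u t = σ u * (t : ℝ) + Je 1 t - Ja (Qc.comp u) t - G (u t) := by simp [r, ι, Gc]
    rw [this]
    rw [abs_le] at h1 h3 h4 h5
    rw [abs_lt]
    constructor <;> linarith [h1.1, h1.2]

/-- The planar periodic problem as a fixed point problem: `V (u, y₀)` is the primitive of
`ψ (y₀ + ∫ (σ(u) + e - a Q(u)) - G(u))`. -/
theorem exists_poincareOperator {T A E : ℝ} {ψ a e Q G : ℝ → ℝ} (hD : BoundedCoeff T a e A E)
    (hψ : Continuous ψ) (hψm : StrictMono ψ) (hψ0 : ψ 0 = 0)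
    (hQ : Continuous Q) (hG : Continuous G) {M N : ℝ} (hM : ∀ x, |Q x| ≤ M)
    (hN : ∀ x, |G x| ≤ N) :
    ∃ (σ : C(Icc (0 : ℝ) T, ℝ) → ℝ) (V : C(Icc (0 : ℝ) T, ℝ) × ℝ → C(Icc (0 : ℝ) T, ℝ)) (Y Λ : ℝ),
      0 ≤ Y ∧ Continuous σ ∧ Continuous V ∧
      (∀ p, V p ⟨0, left_mem_Icc.2 hD.pos.le⟩ = 0) ∧
      (∀ p, |p.2| ≤ Y → ∀ t t', |V p t - V p t'| ≤ Λ * |(t : ℝ) - t'|) ∧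
      (∀ p, Y ≤ p.2 → 0 < V p ⟨T, right_mem_Icc.2 hD.pos.le⟩) ∧
      (∀ p, p.2 ≤ -Y → V p ⟨T, right_mem_Icc.2 hD.pos.le⟩ < 0) ∧
      (∀ u y₀ k, (∀ t, u t = k + V (u, y₀) t) → V (u, y₀) ⟨T, right_mem_Icc.2 hD.pos.le⟩ = 0 →
        ∃ y, IsLienardSol T ψ a e Q G (σ u) (IccExtend hD.pos.le u) y) ∧
      (∀ (u : C(Icc (0 : ℝ) T, ℝ)) (v y : ℝ → ℝ) (s : ℝ), (∀ t : Icc (0 : ℝ) T, u t = v t) →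
        IsLienardSol T ψ a e Q G s v y → σ u = s ∧ (∀ t, u t = v 0 + V (u, y 0) t) ∧
          V (u, y 0) ⟨T, right_mem_Icc.2 hD.pos.le⟩ = 0) := by
  have hT := hD.pos
  have m0 : (0 : ℝ) ∈ Icc 0 T := left_mem_Icc.2 hT.le
  have mT : T ∈ Icc 0 T := right_mem_Icc.2 hT.le
  obtain ⟨σ, r, Y, hσc, hrc, hσ, hr, hrY⟩ := exists_lienardOperator hD hQ hG hM hN
  have hY0 : 0 ≤ Y := (abs_nonneg _).trans (hrY 0 ⟨0, m0⟩).le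
  obtain ⟨J, hJ⟩ := exists_integralCLM (w := fun _ => 1) hT.le measurable_const (W := 1) (by simp)
  let ψc : C(ℝ, ℝ) := ⟨ψ, hψ⟩
  let V : C(Icc (0 : ℝ) T, ℝ) × ℝ → C(Icc (0 : ℝ) T, ℝ) := fun p =>
    J (ψc.comp (ContinuousMap.const _ p.2 + r p.1))
  have hVc : Continuous V := by
    refine J.continuous.comp (ψc.continuous_postcomp.comp ?_)
    exact (ContinuousMap.continuous_const'.comp continuous_snd).add (hrc.comp continuous_fst)
  have hV : ∀ p t, V p t = ∫ τ in (0 : ℝ)..t, ψ (p.2 + IccExtend hT.le (r p.1) τ) := by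
    intro p t
    rw [hJ]
    simp [IccExtend, ψc]
  have hcont : ∀ p : C(Icc (0 : ℝ) T, ℝ) × ℝ,
      Continuous fun τ => ψ (p.2 + IccExtend hT.le (r p.1) τ) := fun p =>
    hψ.comp (continuous_const.add (r p.1).continuous.Icc_extend')
  obtain ⟨Λ, hΛ⟩ : ∃ Λ, ∀ x ∈ Icc (-(2 * Y)) (2 * Y), ‖ψ x‖ ≤ Λ :=
    isCompact_Icc.exists_bound_of_continuousOn hψ.continuousOn
  refine ⟨σ, V, Y, Λ, hY0, hσc, hVc, fun p => ?_, fun p hp t t' => ?_, fun p hp => ?_,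
    fun p hp => ?_, fun u y₀ k hu hVT => ?_, fun u v y s huv h => ?_⟩
  · rw [hV]; simp
  · rw [hV, hV, intervalIntegral.integral_interval_sub_left ((hcont p).intervalIntegrable _ _)
      ((hcont p).intervalIntegrable _ _), ← Real.norm_eq_abs]
    refine intervalIntegral.norm_integral_le_of_norm_le_const fun τ _ => hΛ _ ?_
    have := abs_lt.1 (hrY p.1 (projIcc 0 T hT.le τ))
    have h2 := abs_le.1 hp
    simp only [IccExtend, Function.comp]
    constructor <;> linarith [this.1, this.2, h2.1, h2.2]
  · rw [hV]
    refine intervalIntegral.intervalIntegral_pos_of_pos_on ((hcont p).intervalIntegrable _ _)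
      (fun τ _ => ?_) hT
    refine hψ0.symm.trans_lt (hψm ?_)
    have := (abs_lt.1 (hrY p.1 (projIcc 0 T hT.le τ))).1
    simp only [IccExtend, Function.comp]
    linarith
  · rw [hV]
    have : 0 < ∫ τ in (0 : ℝ)..T, -ψ (p.2 + IccExtend hT.le (r p.1) τ) := by
      refine intervalIntegral.intervalIntegral_pos_of_pos_on
        ((hcont p).neg.intervalIntegrable _ _) (fun τ _ => ?_) hT
      refine neg_pos.2 (lt_of_lt_of_eq (hψm ?_) hψ0)
      have := (abs_lt.1 (hrY p.1 (projIcc 0 T hT.le τ))).2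
      simp only [IccExtend, Function.comp]
      linarith
    rw [intervalIntegral.integral_neg] at this
    simpa using this
  · refine ⟨fun t => y₀ + ∫ τ in (0 : ℝ)..t, (σ u + e τ - a τ * Q (IccExtend hT.le u τ)),
      ⟨fun t ht => ?_, fun t ht => by simp, ?_, ?_⟩⟩
    · have h1 : HasDerivWithinAt
          (fun x => k + ∫ τ in (0 : ℝ)..x, ψ (y₀ + IccExtend hT.le (r u) τ))
          (ψ (y₀ + IccExtend hT.le (r u) t)) (Icc 0 T) t :=
        (((hcont (u, y₀)).integral_hasStrictDerivAt 0 t).hasDerivAt.const_add k).hasDerivWithinAt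
      have h2 : ∀ x ∈ Icc (0 : ℝ) T, IccExtend hT.le u x =
          k + ∫ τ in (0 : ℝ)..x, ψ (y₀ + IccExtend hT.le (r u) τ) := fun x hx => by
        rw [IccExtend_of_mem _ _ hx, hu ⟨x, hx⟩, hV]
      have h3 := h1.congr h2 (h2 t ht)
      have h4 : y₀ + IccExtend hT.le (r u) t = (y₀ + ∫ τ in (0 : ℝ)..t,
          (σ u + e τ - a τ * Q (IccExtend hT.le u τ))) - G (IccExtend hT.le u t) := by
        rw [IccExtend_of_mem _ _ ht, IccExtend_of_mem _ _ ht, hr]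
        ring
      rwa [h4] at h3
    · rw [IccExtend_of_mem _ _ m0, IccExtend_of_mem _ _ mT, hu, hu ⟨T, mT⟩, hVT, hV]
      simp
    · have hc : Continuous fun τ => Q (IccExtend hT.le u τ) := hQ.comp u.continuous.Icc_extend'
      rw [hD.integral_rhs (g := fun τ => Q (IccExtend hT.le u τ)) (σ u) hc.continuousOn m0 mT,
        hσ, hD.integral_e]
      simp
  · have hext : ∀ x ∈ Icc (0 : ℝ) T, IccExtend hT.le u x = v x := fun x hx => by
      rw [IccExtend_of_mem _ _ hx, huv]
    have hσs : σ u = s := by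
      have h1 := h.integral_mul_eq hD hQ
      have h2 := hσ u
      rw [intervalIntegral.integral_congr (g := fun τ => a τ * Q (v τ)), h1] at h2
      · exact (mul_right_cancel₀ hT.ne' h2).symm
      · intro τ hτ
        rw [uIcc_of_le hT.le] at hτ
        simp only [hext τ hτ]
    have hy : ∀ t ∈ Icc (0 : ℝ) T, y 0 + IccExtend hT.le (r u) t = y t - G (v t) := by
      intro t ht
      rw [IccExtend_of_mem _ _ ht, hr, h.y_eq t ht, huv, hσs]
      have : ∫ τ in (0 : ℝ)..t, (s + e τ - a τ * Q (IccExtend hT.le u τ)) =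
          ∫ τ in (0 : ℝ)..t, (s + e τ - a τ * Q (v τ)) := by
        refine intervalIntegral.integral_congr fun τ hτ => ?_
        rw [uIcc_of_le ht.1] at hτ
        simp only [hext τ ⟨hτ.1, hτ.2.trans ht.2⟩]
      simp only [this]
      ring
    have hVv : ∀ t : Icc (0 : ℝ) T, V (u, y 0) t = v t - v 0 := by
      intro t
      rw [hV]
      refine intervalIntegral.integral_eq_sub_of_hasDeriv_right_of_le t.2.1
        (h.continuousOn.mono (Icc_subset_Icc_right t.2.2)) (fun x hx => ?_)
        ((hcont _).intervalIntegrable _ _)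
      have hx' : x ∈ Icc (0 : ℝ) T := ⟨hx.1.le, hx.2.le.trans t.2.2⟩
      simp only
      rw [hy x hx']
      exact ((h.hasDeriv x hx').hasDerivAt (Icc_mem_nhds hx.1 (hx.2.trans_le t.2.2))).hasDerivWithinAt
    refine ⟨hσs, fun t => by rw [hVv, huv]; ring, ?_⟩
    rw [hVv, h.u_per]; simp

/-- Existence of a periodic solution of the system with bounded nonlinearities that touches a given
function `β + c` from below; the shift `c` is either at the boundary of `[c₁, c₂]` or the level
equals `s`, depending on the sign of `θ`. -/
theorem exists_lienardSol_touching {T A E : ℝ} {ψ a e Q G β : ℝ → ℝ} (hD : BoundedCoeff T a e A E)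
    (hψ : Continuous ψ) (hψm : StrictMono ψ) (hψ0 : ψ 0 = 0)
    (hQ : Continuous Q) (hG : Continuous G) {M N : ℝ} (hM : ∀ x, |Q x| ≤ M)
    (hN : ∀ x, |G x| ≤ N) (hβ : ContinuousOn β (Icc 0 T)) {c₁ c₂ : ℝ} (hc : c₁ ≤ c₂) (θ s : ℝ) :
    ∃ c ∈ Icc c₁ c₂, ∃ (σ : ℝ) (u y : ℝ → ℝ), IsLienardSol T ψ a e Q G σ u y ∧
      (∀ t ∈ Icc (0 : ℝ) T, u t ≤ β t + c) ∧ (∃ t ∈ Icc (0 : ℝ) T, u t = β t + c) ∧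
      c = max c₁ (min c₂ (c + θ * (σ - s))) := by
  have hT := hD.pos
  have m0 : (0 : ℝ) ∈ Icc 0 T := left_mem_Icc.2 hT.le
  have mT : T ∈ Icc 0 T := right_mem_Icc.2 hT.le
  obtain ⟨σ, V, Y, Λ, hY0, hσc, hVc, hV0, hVlip, hVpos, hVneg, hVsol, -⟩ :=
    exists_poincareOperator hD hψ hψm hψ0 hQ hG hM hN
  have : Nonempty (Icc (0 : ℝ) T) := ⟨⟨0, m0⟩⟩
  obtain ⟨S, hSc, hS⟩ := exists_continuous_max (X := Icc (0 : ℝ) T)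
  let b : C(Icc (0 : ℝ) T, ℝ) := ⟨fun t => β t, hβ.domRestrict⟩
  let B : ℝ := 2 * (Λ * T) + ‖b‖ + max |c₁| |c₂| + ‖b‖
  have hΛ0 : 0 ≤ Λ * T := by
    have := hVlip (0, 0) (by simpa using hY0) ⟨T, mT⟩ ⟨0, m0⟩
    have h2 := (abs_nonneg _).trans this
    simpa [abs_of_pos hT] using h2
  have hΛ : 0 ≤ Λ := nonneg_of_mul_nonneg_left hΛ0 hT
  let K : Set (C(Icc (0 : ℝ) T, ℝ) × ℝ × ℝ) :=
    lipschitzBall T Λ B ×ˢ (Icc (-Y) Y ×ˢ Icc c₁ c₂)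
  let top : Icc (0 : ℝ) T := ⟨T, mT⟩
  let W : C(Icc (0 : ℝ) T, ℝ) × ℝ × ℝ → C(Icc (0 : ℝ) T, ℝ) := fun p => V (p.1, p.2.1)
  have hWc : Continuous W := hVc.comp (by fun_prop)
  let k : C(Icc (0 : ℝ) T, ℝ) × ℝ × ℝ → ℝ := fun p => p.2.2 - S (W p - b)
  have hkc : Continuous k :=
    (continuous_snd.comp continuous_snd).sub (hSc.comp (hWc.sub continuous_const))
  let Φ : C(Icc (0 : ℝ) T, ℝ) × ℝ × ℝ → C(Icc (0 : ℝ) T, ℝ) × ℝ × ℝ := fun p =>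
    (W p + ContinuousMap.const _ (k p),
      max (-Y) (min Y (p.2.1 - W p top)),
      max c₁ (min c₂ (p.2.2 + θ * (σ p.1 - s))))
  have hΦc : Continuous Φ := by
    refine Continuous.prodMk (hWc.add (ContinuousMap.continuous_const'.comp hkc))
      (Continuous.prodMk ?_ ?_)
    · exact continuous_const.max (continuous_const.min
        ((continuous_fst.comp continuous_snd).sub ((continuous_eval_const top).comp hWc)))
    · exact continuous_const.max (continuous_const.min ((continuous_snd.comp continuous_snd).add
        (continuous_const.mul ((hσc.comp continuous_fst).sub continuous_const))))
  have hmaps : MapsTo Φ K K := by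
    rintro ⟨u, y₀, c⟩ ⟨hu, hy₀, hcc⟩
    simp only at hy₀ hcc
    have hlip := hVlip (u, y₀) (abs_le.2 hy₀)
    have hbnd : ∀ t, |V (u, y₀) t| ≤ Λ * T := fun t => by
      have := hlip t ⟨0, m0⟩
      rw [hV0, sub_zero] at this
      refine this.trans ?_
      simp only [sub_zero]
      rw [abs_of_nonneg t.2.1]
      gcongr
      exact t.2.2
    refine ⟨⟨fun t => ?_, fun t t' => ?_⟩, ⟨?_, ?_⟩, ⟨?_, ?_⟩⟩
    · obtain ⟨t₁, ht₁⟩ := (hS (V (u, y₀) - b)).2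
      have h1 := abs_le.1 (hbnd t₁)
      have h2 := abs_le.1 (hbnd t)
      have h3 := abs_le.1 (b.norm_coe_le_norm t₁)
      have h4 : |c| ≤ max |c₁| |c₂| := abs_le_max_abs_abs hcc.1 hcc.2
      have h5 := abs_le.1 h4
      have h6 : 0 ≤ ‖b‖ := norm_nonneg _
      have h7 : V (u, y₀) t₁ - b t₁ = S (V (u, y₀) - b) := ht₁
      change |V (u, y₀) t + (c - S (V (u, y₀) - b))| ≤ B
      rw [← h7, abs_le]
      constructor <;> simp only [B] <;> linarith [h1.1, h1.2, h2.1, h2.2, h3.1, h3.2, h5.1, h5.2]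
    · change |V (u, y₀) t + k _ - (V (u, y₀) t' + k _)| ≤ _
      rw [add_sub_add_right_eq_sub]
      exact hlip t t'
    · exact le_max_left _ _
    · exact max_le (by linarith) (min_le_left _ _)
    · exact le_max_left _ _
    · exact max_le hc (min_le_left _ _)
  have hne : K.Nonempty := by
    refine ⟨(0, 0, c₁), ⟨fun t => ?_, fun t t' => ?_⟩, ⟨by simpa using hY0, by simpa using hY0⟩,
      left_mem_Icc.2 hc⟩
    · have : 0 ≤ max |c₁| |c₂| := (abs_nonneg _).trans (le_max_left _ _)
      simp only [ContinuousMap.zero_apply, abs_zero, B]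
      positivity
    · simp only [ContinuousMap.zero_apply, sub_zero, abs_zero]
      positivity
  obtain ⟨⟨u, y₀, c⟩, hK, hfix⟩ := exists_fixedPoint_of_isCompact_convex
    ((convex_lipschitzBall T Λ B).prod ((convex_Icc (-Y) Y).prod (convex_Icc c₁ c₂)))
    ((isCompact_lipschitzBall T Λ B).prod (isCompact_Icc.prod isCompact_Icc)) hne
    hΦc.continuousOn hmaps
  obtain ⟨-, hy₀, hcc⟩ := hK
  simp only at hy₀ hcc
  simp only [Φ, Prod.mk.injEq] at hfix
  obtain ⟨hfu, hfy, hfc⟩ := hfix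
  have hu : ∀ t, u t = (c - S (V (u, y₀) - b)) + V (u, y₀) t := fun t => by
    have := DFunLike.congr_fun hfu t
    rw [← this, add_comm]
    rfl
  have hVT : V (u, y₀) top = 0 := by
    have hW : W (u, y₀, c) top = V (u, y₀) top := rfl
    rw [hW] at hfy
    rcases lt_trichotomy (V (u, y₀) top) 0 with h | h | h
    · exfalso
      rcases le_or_gt Y (y₀ - V (u, y₀) top) with h1 | h1
      · rw [min_eq_left h1, max_eq_right (by linarith)] at hfy
        exact absurd (hVpos (u, y₀) hfy.le) (not_lt.2 h.le)
      · rw [min_eq_right h1.le, max_eq_right (by linarith [hy₀.1])] at hfy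
        linarith
    · exact h
    · exfalso
      have h1 : y₀ - V (u, y₀) top ≤ Y := by linarith [hy₀.2]
      rw [min_eq_right h1] at hfy
      rcases le_or_gt (-Y) (y₀ - V (u, y₀) top) with h2 | h2
      · rw [max_eq_right h2] at hfy
        linarith
      · rw [max_eq_left h2.le] at hfy
        exact absurd (hVneg (u, y₀) hfy.symm.le) (not_lt.2 h.le)
  obtain ⟨y, hy⟩ := hVsol u y₀ _ hu hVT
  refine ⟨c, hcc, σ u, _, y, hy, fun t ht => ?_, ?_, hfc.symm⟩
  · rw [IccExtend_of_mem _ _ ht, hu]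
    have := (hS (V (u, y₀) - b)).1 ⟨t, ht⟩
    have h2 : V (u, y₀) ⟨t, ht⟩ - β t ≤ S (V (u, y₀) - b) := this
    linarith
  · obtain ⟨t, ht⟩ := (hS (V (u, y₀) - b)).2
    have h2 : V (u, y₀) t - β t = S (V (u, y₀) - b) := ht
    refine ⟨t, t.2, ?_⟩
    rw [IccExtend_of_mem _ _ t.2, hu, ← h2]
    change c - (V (u, y₀) t - β t) + V (u, y₀) t = _
    ring

theorem HasDerivWithinAt.comp_primitive {G u : ℝ → ℝ} {u' t : ℝ} {s : Set ℝ} (hG : Continuous G)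
    (hu : HasDerivWithinAt u u' s t) :
    HasDerivWithinAt (fun x => ∫ τ in (0 : ℝ)..u x, G τ) (G (u t) * u') s t :=
  (hG.integral_hasStrictDerivAt 0 (u t)).hasDerivAt.comp_hasDerivWithinAt t hu

theorem IsLienardSol.sub_y_eq {T A E σ : ℝ} {ψ a e Q G u y : ℝ → ℝ}
    (hD : BoundedCoeff T a e A E) (hQ : Continuous Q) (h : IsLienardSol T ψ a e Q G σ u y)
    {t t' : ℝ} (ht : t ∈ Icc 0 T) (ht' : t' ∈ Icc 0 T) :
    y t' - y t = ∫ τ in t..t', (σ + e τ - a τ * Q (u τ)) := by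
  have h0 : (0 : ℝ) ∈ Icc 0 T := left_mem_Icc.2 hD.pos.le
  have hc : ContinuousOn (fun τ => Q (u τ)) (Icc 0 T) := hQ.comp_continuousOn h.continuousOn
  rw [h.y_eq t ht, h.y_eq t' ht', add_sub_add_left_eq_sub,
    intervalIntegral.integral_interval_sub_left (hD.intervalIntegrable_rhs σ hc h0 ht')
      (hD.intervalIntegrable_rhs σ hc h0 ht)]

theorem IsLienardSol.abs_y_sub_le {T A E σ m S : ℝ} {ψ a e Q G u y : ℝ → ℝ}
    (hD : BoundedCoeff T a e A E) (hQ : Continuous Q) (h : IsLienardSol T ψ a e Q G σ u y)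
    (hm : 0 ≤ m) (hQm : ∀ x, -m ≤ Q x) (hσ : σ ≤ S) {t : ℝ} (ht : t ∈ Icc 0 T) :
    |y t - y 0| ≤ (|S| + E + A * m) * T := by
  have hT := hD.pos
  have h0 : (0 : ℝ) ∈ Icc 0 T := left_mem_Icc.2 hD.pos.le
  have h1 : T ∈ Icc 0 T := right_mem_Icc.2 hD.pos.le
  have hc : ContinuousOn (fun τ => Q (u τ)) (Icc 0 T) := hQ.comp_continuousOn h.continuousOn
  have hA : 0 ≤ A := (hD.a_nonneg 0).trans (hD.a_le 0)
  have hE : 0 ≤ E := (abs_nonneg _).trans (hD.abs_e_le 0)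
  have key : ∀ x ∈ Icc 0 T, ∀ x' ∈ Icc 0 T, x ≤ x' → y x' - y x ≤ (|S| + E + A * m) * T := by
    intro x hx x' hx' hxx
    rw [h.sub_y_eq hD hQ hx hx']
    calc ∫ τ in x..x', (σ + e τ - a τ * Q (u τ)) ≤ ∫ τ in x..x', (|S| + E + A * m) := by
          refine intervalIntegral.integral_mono_on hxx (hD.intervalIntegrable_rhs σ hc hx hx')
            intervalIntegrable_const fun τ _ => ?_
          have h2 := (abs_le.1 (hD.abs_e_le τ)).2
          have h3 : a τ * -m ≤ a τ * Q (u τ) := mul_le_mul_of_nonneg_left (hQm _) (hD.a_nonneg τ)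
          have h4 : a τ * m ≤ A * m := mul_le_mul_of_nonneg_right (hD.a_le τ) hm
          linarith [le_abs_self S]
      _ = (|S| + E + A * m) * (x' - x) := by
          rw [intervalIntegral.integral_const, smul_eq_mul, mul_comm]
      _ ≤ (|S| + E + A * m) * T := by
          gcongr
          linarith [hx.1, hx'.2]
  rw [abs_le]
  constructor
  · have := key t ht T h1 ht.2
    rw [← h.y_per] at this
    linarith
  · exact key 0 h0 t ht ht.1

/-- A priori bound for the oscillation of periodic solutions, uniform in the nonlinearities. -/
theorem exists_oscillation_bound {T A E : ℝ} {ψ a e : ℝ → ℝ} (hD : BoundedCoeff T a e A E)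
    (hψm : StrictMono ψ) (hψ0 : ψ 0 = 0) {m : ℝ} (hm : 0 ≤ m) (S : ℝ) :
    ∃ C, 0 ≤ C ∧ ∀ (Q G : ℝ → ℝ) (σ : ℝ) (u y : ℝ → ℝ), Continuous Q → Continuous G →
      (∀ x, -m ≤ Q x) → σ ≤ S → IsLienardSol T ψ a e Q G σ u y →
      ∀ t ∈ Icc (0 : ℝ) T, ∀ t' ∈ Icc (0 : ℝ) T, |u t - u t'| ≤ C := by
  have hT := hD.pos
  have hA : 0 ≤ A := (hD.a_nonneg 0).trans (hD.a_le 0)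
  have hE : 0 ≤ E := (abs_nonneg _).trans (hD.abs_e_le 0)
  obtain ⟨R, hR⟩ : ∃ R, R = (|S| + E + A * m) * T := ⟨_, rfl⟩
  have hR0 : 0 ≤ R := by rw [hR]; positivity
  let X := max (ψ (R + 1)) (-ψ (-(R + 1)))
  have hX0 : 0 ≤ X := by
    refine le_trans ?_ (le_max_left _ _)
    rw [← hψ0]
    exact hψm.monotone (by linarith)
  obtain ⟨D, hDef⟩ : ∃ D, D = (R + 1) * X := ⟨_, rfl⟩
  have hD0 : 0 ≤ D := by rw [hDef]; positivity
  have hcoer : ∀ z, (R + 1) * |ψ z| - D ≤ z * ψ z := by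
    intro z
    rcases le_total 0 z with hz | hz
    · have h1 : 0 ≤ ψ z := hψ0 ▸ hψm.monotone hz
      rw [abs_of_nonneg h1]
      rcases le_total (R + 1) z with h2 | h2
      · nlinarith
      · have h3 : ψ z ≤ X := (hψm.monotone h2).trans (le_max_left _ _)
        nlinarith [mul_nonneg hz h1]
    · have h1 : ψ z ≤ 0 := (hψm.monotone hz).trans_eq hψ0
      rw [abs_of_nonpos h1]
      rcases le_total z (-(R + 1)) with h2 | h2
      · nlinarith
      · have h3 : -ψ z ≤ X := (neg_le_neg (hψm.monotone h2)).trans (le_max_right _ _)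
        nlinarith [mul_nonneg_of_nonpos_of_nonpos hz h1]
  refine ⟨D * T, by positivity, fun Q G σ u y hQ hG hQm hσ h => ?_⟩
  have hyR : ∀ t ∈ Icc 0 T, |y t - y 0| ≤ R := fun t ht => by
    rw [hR]; exact h.abs_y_sub_le hD hQ hm hQm hσ ht
  let w : ℝ → ℝ := fun t => y 0 * u t - ∫ τ in (0 : ℝ)..u t, G τ
  let p : ℝ → ℝ := fun t => ψ (y t - G (u t))
  have hw : ∀ t ∈ Icc 0 T, HasDerivWithinAt w (y 0 * p t - G (u t) * p t) (Icc 0 T) t :=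
    fun t ht => ((h.hasDeriv t ht).const_mul (y 0)).sub ((h.hasDeriv t ht).comp_primitive hG)
  have hineq : ∀ t ∈ Icc 0 T, |p t| - D ≤ y 0 * p t - G (u t) * p t := by
    intro t ht
    have h1 := hcoer (y t - G (u t))
    have h2 : (y t - y 0) * p t ≤ R * |p t| :=
      (le_abs_self _).trans (by rw [abs_mul]; gcongr; exact hyR t ht)
    change (R + 1) * |p t| - D ≤ (y t - G (u t)) * p t at h1
    linarith
  have hw0 : w 0 = w T := by simp only [w, h.u_per]
  -- `w + D t` increases at least as fast as `|u|` does
  have hmono : ∀ ε : ℝ, |ε| ≤ 1 → ∀ t ∈ Icc 0 T, ∀ t' ∈ Icc 0 T, t ≤ t' →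
      ε * (u t' - u t) ≤ D * (t' - t) + (w t' - w t) := by
    intro ε hε t ht t' ht' htt
    have hder : ∀ x ∈ Icc 0 T, HasDerivWithinAt (fun x => D * x + w x - ε * u x)
        (D * 1 + (y 0 * p x - G (u x) * p x) - ε * p x) (Icc 0 T) x := fun x hx =>
      (((hasDerivWithinAt_id x _).const_mul D).add (hw x hx)).sub ((h.hasDeriv x hx).const_mul ε)
    have hmon : MonotoneOn (fun x => D * x + w x - ε * u x) (Icc 0 T) := by
      refine monotoneOn_of_hasDerivWithinAt_nonneg (convex_Icc 0 T)
        (fun x hx => (hder x hx).continuousWithinAt)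
        (fun x hx => (hder x (interior_subset hx)).mono interior_subset) fun x hx => ?_
      have h1 := hineq x (interior_subset hx)
      have h2 : ε * p x ≤ |p x| := (le_abs_self _).trans (by
        rw [abs_mul]; exact mul_le_of_le_one_left (abs_nonneg _) hε)
      linarith
    have := hmon ht ht' htt
    simp only at this
    linarith
  have main : ∀ ε : ℝ, |ε| ≤ 1 → ∀ t ∈ Icc 0 T, ∀ t' ∈ Icc 0 T, t ≤ t' →
      ε * (u t' - u t) ≤ D * T := by
    intro ε hε t ht t' ht' htt
    have h1 := hmono ε hε t ht t' ht' htt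
    have h2 := hmono 0 (by simp) 0 (left_mem_Icc.2 hT.le) t ht ht.1
    have h3 := hmono 0 (by simp) t' ht' T (right_mem_Icc.2 hT.le) ht'.2
    rw [zero_mul] at h2 h3
    linarith
  have habs : ∀ t ∈ Icc 0 T, ∀ t' ∈ Icc 0 T, t ≤ t' → |u t' - u t| ≤ D * T := by
    intro t ht t' ht' htt
    rw [abs_le]
    constructor
    · linarith [main (-1) (by simp) t ht t' ht' htt]
    · linarith [main 1 (by simp) t ht t' ht' htt]
  intro t ht t' ht'
  rcases le_total t t' with htt | htt
  · rw [abs_sub_comm]; exact habs t ht t' ht' htt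
  · exact habs t' ht' t ht htt

/-- `(β, z)` is a `T`-periodic upper solution of the planar system at level `σ`: the second
equation is replaced by the inequality `z' ≤ σ + e(t) - a(t) Q(β)`. -/
structure IsUpperSol (T : ℝ) (ψ a e Q G : ℝ → ℝ) (σ : ℝ) (β z : ℝ → ℝ) : Prop where
  hasDeriv : ∀ t ∈ Icc (0 : ℝ) T, HasDerivWithinAt β (ψ (z t - G (β t))) (Icc (0 : ℝ) T) t
  sub_le : ∀ t ∈ Icc (0 : ℝ) T, ∀ t' ∈ Icc (0 : ℝ) T, t ≤ t' →
    z t' - z t ≤ ∫ τ in t..t', (σ + e τ - a τ * Q (β τ))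
  β_per : β 0 = β T
  z_per : z 0 = z T

theorem IsLienardSol.isUpperSol {T A E σ : ℝ} {ψ a e Q G u y : ℝ → ℝ}
    (hD : BoundedCoeff T a e A E) (hQ : Continuous Q) (h : IsLienardSol T ψ a e Q G σ u y) :
    IsUpperSol T ψ a e Q G σ u y :=
  ⟨h.hasDeriv, fun _ ht _ ht' _ => (h.sub_y_eq hD hQ ht ht').le, h.u_per, h.y_per⟩

theorem IsUpperSol.congr {T σ : ℝ} {ψ a e Q G Q' G' β z : ℝ → ℝ}
    (h : IsUpperSol T ψ a e Q G σ β z) (hQ : ∀ t ∈ Icc (0 : ℝ) T, Q' (β t) = Q (β t))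
    (hG : ∀ t ∈ Icc (0 : ℝ) T, G' (β t) = G (β t)) : IsUpperSol T ψ a e Q' G' σ β z := by
  refine ⟨fun t ht => ?_, fun t ht t' ht' htt => ?_, h.β_per, h.z_per⟩
  · rw [hG t ht]; exact h.hasDeriv t ht
  · refine (h.sub_le t ht t' ht' htt).trans_eq (intervalIntegral.integral_congr fun τ hτ => ?_)
    rw [uIcc_of_le htt] at hτ
    simp only [hQ τ ⟨ht.1.trans hτ.1, hτ.2.trans ht'.2⟩]

theorem IsLienardSol.congr {T σ : ℝ} {ψ a e Q G Q' G' u y : ℝ → ℝ}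
    (h : IsLienardSol T ψ a e Q G σ u y) (hQ : ∀ t ∈ Icc (0 : ℝ) T, Q' (u t) = Q (u t))
    (hG : ∀ t ∈ Icc (0 : ℝ) T, G' (u t) = G (u t)) : IsLienardSol T ψ a e Q' G' σ u y := by
  refine ⟨fun t ht => ?_, fun t ht => ?_, h.u_per, h.y_per⟩
  · rw [hG t ht]; exact h.hasDeriv t ht
  · rw [h.y_eq t ht]
    congr 1
    refine intervalIntegral.integral_congr fun τ hτ => ?_
    rw [uIcc_of_le ht.1] at hτ
    simp only [hQ τ ⟨hτ.1, hτ.2.trans ht.2⟩]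

theorem HasDerivWithinAt.nonneg_of_nonneg_right {g : ℝ → ℝ} {d x y : ℝ} (hxy : x < y) {s : Set ℝ}
    (hs : Ioo x y ⊆ s) (h : HasDerivWithinAt g d s x) (h0 : g x = 0)
    (hg : ∀ t ∈ Ioo x y, 0 ≤ g t) : 0 ≤ d := by
  have h1 := (hasDerivWithinAt_iff_tendsto_slope' (by simp)).1 (h.mono hs)
  rw [nhdsWithin_Ioo_eq_nhdsGT hxy] at h1
  refine ge_of_tendsto h1 ?_
  filter_upwards [Ioo_mem_nhdsGT hxy] with t ht
  rw [slope_def_field, h0, sub_zero]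
  exact div_nonneg (hg t ht) (sub_nonneg.2 ht.1.le)

theorem HasDerivWithinAt.nonpos_of_nonneg_left {g : ℝ → ℝ} {d x y : ℝ} (hxy : x < y) {s : Set ℝ}
    (hs : Ioo x y ⊆ s) (h : HasDerivWithinAt g d s y) (h0 : g y = 0)
    (hg : ∀ t ∈ Ioo x y, 0 ≤ g t) : d ≤ 0 := by
  have h1 := (hasDerivWithinAt_iff_tendsto_slope' (by simp)).1 (h.mono hs)
  rw [nhdsWithin_Ioo_eq_nhdsLT hxy] at h1
  refine le_of_tendsto h1 ?_
  filter_upwards [Ioo_mem_nhdsLT hxy] with t ht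
  rw [slope_def_field, h0, sub_zero]
  exact div_nonpos_of_nonneg_of_nonpos (hg t ht) (sub_nonpos.2 ht.2.le)

/-- A solution touching an upper solution from below has at most the level of the latter. -/
theorem IsLienardSol.level_le_of_touching {T A E σ σ' K : ℝ} {ψ a e Q G u y β z : ℝ → ℝ}
    (hD : BoundedCoeff T a e A E) (hψm : StrictMono ψ) (hQ : Continuous Q)
    (hG : ∀ x x', |G x - G x'| ≤ K * |x - x'|)
    (h : IsLienardSol T ψ a e Q G σ' u y) (hβ : IsUpperSol T ψ a e Q G σ β z)
    (hle : ∀ t ∈ Icc (0 : ℝ) T, u t ≤ β t) (htouch : ∃ t ∈ Icc (0 : ℝ) T, u t = β t) :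
    σ' ≤ σ := by
  have hT := hD.pos
  have hA : 0 ≤ A := (hD.a_nonneg 0).trans (hD.a_le 0)
  have hK : 0 ≤ K := by simpa using (abs_nonneg _).trans (hG 1 0)
  have m0 : (0 : ℝ) ∈ Icc 0 T := left_mem_Icc.2 hT.le
  have mT : T ∈ Icc 0 T := right_mem_Icc.2 hT.le
  obtain ⟨t₀, ht₀, ht₀T, heq⟩ : ∃ t ∈ Icc (0 : ℝ) T, t < T ∧ u t = β t := by
    obtain ⟨t, ht, hut⟩ := htouch
    rcases ht.2.lt_or_eq with h1 | rfl
    · exact ⟨t, ht, h1, hut⟩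
    · exact ⟨0, m0, hT, by rw [h.u_per, hβ.β_per, hut]⟩
  have hder : ∀ t ∈ Icc 0 T, HasDerivWithinAt (fun x => β x - u x)
      (ψ (z t - G (β t)) - ψ (y t - G (u t))) (Icc 0 T) t := fun t ht =>
    (hβ.hasDeriv t ht).sub (h.hasDeriv t ht)
  have hnn : ∀ t ∈ Icc 0 T, 0 ≤ β t - u t := fun t ht => sub_nonneg.2 (hle t ht)
  have hd0 : ψ (z t₀ - G (β t₀)) - ψ (y t₀ - G (u t₀)) = 0 := by
    refine le_antisymm ?_ ?_
    · rcases ht₀.1.eq_or_lt with h1 | h1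
      · have hper : ψ (z t₀ - G (β t₀)) - ψ (y t₀ - G (u t₀)) =
            ψ (z T - G (β T)) - ψ (y T - G (u T)) := by
          rw [← h1, h.u_per, h.y_per, hβ.β_per, hβ.z_per]
        rw [hper]
        refine (hder T mT).nonpos_of_nonneg_left hT Ioo_subset_Icc_self ?_
          fun t ht => hnn t (Ioo_subset_Icc_self ht)
        rw [← h.u_per, ← hβ.β_per, sub_eq_zero, h1, heq]
      · have hsub : Ioo 0 t₀ ⊆ Icc 0 T := fun t ht => ⟨ht.1.le, ht.2.le.trans ht₀.2⟩
        exact (hder t₀ ht₀).nonpos_of_nonneg_left h1 hsub (by rw [heq, sub_self])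
          fun t ht => hnn t (hsub ht)
    · have hsub : Ioo t₀ T ⊆ Icc 0 T := fun t ht => ⟨ht₀.1.trans ht.1.le, ht.2.le⟩
      exact (hder t₀ ht₀).nonneg_of_nonneg_right ht₀T hsub (by rw [heq, sub_self])
        fun t ht => hnn t (hsub ht)
  have hyz : y t₀ = z t₀ := by
    have := hψm.injective (sub_eq_zero.1 hd0)
    rw [heq] at this
    linarith
  by_contra! hlt
  obtain ⟨ε, hε⟩ : ∃ ε, ε = σ' - σ := ⟨_, rfl⟩
  have hε0 : 0 < ε := by linarith
  have hβc : ContinuousOn β (Icc 0 T) := fun t ht => (hβ.hasDeriv t ht).continuousWithinAt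
  have hQuc : ContinuousOn (fun τ => Q (u τ)) (Icc 0 T) := hQ.comp_continuousOn h.continuousOn
  have hQβc : ContinuousOn (fun τ => Q (β τ)) (Icc 0 T) := hQ.comp_continuousOn hβc
  have hfilter : nhdsWithin t₀ (Icc t₀ T) ≤ nhdsWithin t₀ (Icc 0 T) :=
    nhdsWithin_mono _ (Icc_subset_Icc_left ht₀.1)
  have ev1 : ∀ᶠ t in nhdsWithin t₀ (Icc t₀ T), A * (Q (u t) - Q (β t)) < ε / 4 := by
    have hc : ContinuousWithinAt (fun t => A * (Q (u t) - Q (β t))) (Icc 0 T) t₀ :=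
      (continuousOn_const.mul (hQuc.sub hQβc)) t₀ ht₀
    refine (hc.mono_left hfilter).eventually_lt_const ?_
    simpa [heq] using hε0
  have ev2 : ∀ᶠ t in nhdsWithin t₀ (Icc t₀ T), K * |β t - u t| ≤ ε / 4 * |t - t₀| := by
    have h1 := (hasDerivWithinAt_iff_isLittleO.1 (hd0 ▸ hder t₀ ht₀)).mono hfilter
    have h2 := h1.def (c := ε / (4 * (K + 1))) (by positivity)
    filter_upwards [h2] with t ht
    rw [heq] at ht
    simp only [sub_self, sub_zero, smul_zero, Real.norm_eq_abs] at ht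
    calc K * |β t - u t| ≤ (K + 1) * (ε / (4 * (K + 1)) * |t - t₀|) := by
          gcongr; linarith
      _ = ε / 4 * |t - t₀| := by field_simp
  obtain ⟨t₁, ht₁, hsub⟩ : ∃ t₁, t₀ < t₁ ∧ Icc t₀ t₁ ⊆ {t | (t ∈ Icc t₀ T) ∧
      A * (Q (u t) - Q (β t)) < ε / 4 ∧ K * |β t - u t| ≤ ε / 4 * |t - t₀|} := by
    rw [← mem_nhdsGE_iff_exists_Icc_subset, ← nhdsWithin_Icc_eq_nhdsGE ht₀T]
    filter_upwards [ev1, ev2, self_mem_nhdsWithin] with t h1 h2 h3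
    exact ⟨h3, h1, h2⟩
  have hmem : ∀ t ∈ Icc t₀ t₁, t ∈ Icc 0 T := fun t ht =>
    ⟨ht₀.1.trans ht.1, (hsub ht).1.2⟩
  have hygap : ∀ t ∈ Icc t₀ t₁, 3 / 4 * ε * (t - t₀) ≤ y t - z t := by
    intro t ht
    have htm := hmem t ht
    have h1 := h.sub_y_eq hD hQ ht₀ htm
    have h2 := hβ.sub_le t₀ ht₀ t htm ht.1
    have h3 : ∫ τ in t₀..t, ((σ + e τ - a τ * Q (β τ)) + 3 / 4 * ε) ≤
        ∫ τ in t₀..t, (σ' + e τ - a τ * Q (u τ)) := by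
      refine intervalIntegral.integral_mono_on ht.1
        ((hD.intervalIntegrable_rhs σ hQβc ht₀ htm).add intervalIntegrable_const)
        (hD.intervalIntegrable_rhs σ' hQuc ht₀ htm) fun τ hτ => ?_
      have h4 := (hsub ⟨hτ.1, hτ.2.trans ht.2⟩).2.1
      have h5 : a τ * (Q (u τ) - Q (β τ)) ≤ ε / 4 := by
        rcases le_total 0 (Q (u τ) - Q (β τ)) with h6 | h6
        · exact (mul_le_mul_of_nonneg_right (hD.a_le τ) h6).trans h4.le
        · exact (mul_nonpos_of_nonneg_of_nonpos (hD.a_nonneg τ) h6).trans (by positivity)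
      linarith
    rw [intervalIntegral.integral_add (hD.intervalIntegrable_rhs σ hQβc ht₀ htm)
      intervalIntegrable_const, intervalIntegral.integral_const, smul_eq_mul] at h3
    linarith
  have hanti : StrictAntiOn (fun x => β x - u x) (Icc t₀ t₁) := by
    refine strictAntiOn_of_hasDerivWithinAt_neg (convex_Icc t₀ t₁)
      (fun x hx => (hder x (hmem x hx)).continuousWithinAt.mono hmem)
      (fun x hx => (hder x (hmem x (interior_subset hx))).mono
        fun t ht => hmem t (interior_subset ht)) fun x hx => ?_
    rw [interior_Icc] at hx
    have hx' := Ioo_subset_Icc_self hx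
    have h1 := hygap x hx'
    have h2 := (hsub hx').2.2
    have h3 := (abs_le.1 (hG (β x) (u x))).1
    rw [abs_of_pos (sub_pos.2 hx.1)] at h2
    have h4 : 0 < ε * (x - t₀) := mul_pos hε0 (sub_pos.2 hx.1)
    exact sub_neg.2 (hψm (by linarith))
  have := hanti (left_mem_Icc.2 ht₁.le) (right_mem_Icc.2 ht₁.le) ht₁
  simp only [heq, sub_self] at this
  exact absurd (hle t₁ (hmem t₁ (right_mem_Icc.2 ht₁.le))) (not_le.2 (by linarith))

/-- Truncation of the real line to `[-L, L]`. -/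
def clampTo (L x : ℝ) : ℝ := max (-L) (min L x)

theorem continuous_clampTo (L : ℝ) : Continuous (clampTo L) := by
  unfold clampTo; fun_prop

theorem clampTo_mem {L : ℝ} (hL : 0 ≤ L) (x : ℝ) : clampTo L x ∈ Icc (-L) L :=
  ⟨le_max_left _ _, max_le (by linarith) (min_le_left _ _)⟩

theorem clampTo_eq_self {L x : ℝ} (hx : |x| ≤ L) : clampTo L x = x := by
  rw [abs_le] at hx
  rw [clampTo, min_eq_right hx.2, max_eq_right hx.1]

theorem abs_clampTo_sub_le (L x y : ℝ) : |clampTo L x - clampTo L y| ≤ |x - y| := by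
  unfold clampTo
  refine (abs_max_sub_max_le_max _ _ _ _).trans ?_
  rw [sub_self, abs_zero]
  refine max_le (abs_nonneg _) ((abs_min_sub_min_le_max _ _ _ _).trans ?_)
  rw [sub_self, abs_zero]
  exact max_le (abs_nonneg _) le_rfl

/-- Standing assumptions on the planar system `u' = ψ(y - F(u))`, `y' = σ + e - a q(u)`. -/
structure LienardData (T : ℝ) (ψ a e q F : ℝ → ℝ) (A E m : ℝ) : Prop where
  coeff : BoundedCoeff T a e A E
  ψ_cont : Continuous ψ
  ψ_mono : StrictMono ψ
  ψ_zero : ψ 0 = 0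
  q_cont : Continuous q
  F_cont : Continuous F
  F_lip : ∀ L, ∃ K, ∀ x ∈ Icc (-L) L, ∀ x' ∈ Icc (-L) L, |F x - F x'| ≤ K * |x - x'|
  m_nonneg : 0 ≤ m
  q_ge : ∀ x, -m ≤ q x

namespace LienardData

variable {T A E m : ℝ} {ψ a e q F : ℝ → ℝ}

theorem exists_oscillation_bound (h : LienardData T ψ a e q F A E m) (S : ℝ) :
    ∃ C, 0 ≤ C ∧ ∀ (Q G : ℝ → ℝ) (σ : ℝ) (u y : ℝ → ℝ), Continuous Q → Continuous G →
      (∀ x, -m ≤ Q x) → σ ≤ S → IsLienardSol T ψ a e Q G σ u y →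
      ∀ t ∈ Icc (0 : ℝ) T, ∀ t' ∈ Icc (0 : ℝ) T, |u t - u t'| ≤ C :=
  _root_.exists_oscillation_bound h.coeff h.ψ_mono h.ψ_zero h.m_nonneg S

/-- If `k ≤ q` along a solution, its level is at least `k` times the mean value of `a`. -/
theorem mul_le_level (h : LienardData T ψ a e q F A E m) {σ k abar : ℝ} {u y : ℝ → ℝ}
    (habar : ∫ t in (0 : ℝ)..T, a t = abar * T) (hu : IsLienardSol T ψ a e q F σ u y)
    (hk : ∀ t ∈ Icc (0 : ℝ) T, k ≤ q (u t)) : abar * k ≤ σ := by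
  have hT := h.coeff.pos
  have h0 : (0 : ℝ) ∈ Icc 0 T := left_mem_Icc.2 hT.le
  have h1 : T ∈ Icc 0 T := right_mem_Icc.2 hT.le
  have hmono : ∫ τ in (0 : ℝ)..T, a τ * k ≤ ∫ τ in (0 : ℝ)..T, a τ * q (u τ) :=
    intervalIntegral.integral_mono_on hT.le
      (h.coeff.intervalIntegrable_mul continuousOn_const h0 h1)
      (h.coeff.intervalIntegrable_mul (h.q_cont.comp_continuousOn hu.continuousOn) h0 h1)
      fun τ hτ => mul_le_mul_of_nonneg_left (hk τ hτ) (h.coeff.a_nonneg τ)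
  rw [hu.integral_mul_eq h.coeff h.q_cont, intervalIntegral.integral_mul_const, habar] at hmono
  exact le_of_mul_le_mul_right (by linarith) hT

/-- Truncating the nonlinearities at a large level, one obtains a solution touching `β + c`; it
solves the original system as soon as its level is at most `S`. -/
theorem exists_sol_touching (h : LienardData T ψ a e q F A E m) {σβ : ℝ} {β z : ℝ → ℝ}
    (hβ : IsUpperSol T ψ a e q F σβ β z) (S : ℝ) :
    ∃ D, (∀ t ∈ Icc (0 : ℝ) T, |β t| ≤ D) ∧ ∀ (c₁ c₂ θ s : ℝ), c₁ ≤ c₂ →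
      ∃ c ∈ Icc c₁ c₂, ∃ (σ : ℝ) (u : ℝ → ℝ), (∀ t ∈ Icc (0 : ℝ) T, u t ≤ β t + c) ∧
        (∃ t ∈ Icc (0 : ℝ) T, u t = β t + c) ∧ c = max c₁ (min c₂ (c + θ * (σ - s))) ∧
        (c = 0 → σ ≤ σβ) ∧ (σ ≤ S → (∀ t ∈ Icc (0 : ℝ) T, |u t - c| ≤ D) ∧
          ∃ y, IsLienardSol T ψ a e q F σ u y) := by
  obtain ⟨C, hC0, hC⟩ := h.exists_oscillation_bound S
  have hβc : ContinuousOn β (Icc 0 T) := fun t ht => (hβ.hasDeriv t ht).continuousWithinAt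
  obtain ⟨B, hB⟩ := isCompact_Icc.exists_bound_of_continuousOn hβc
  have hB : ∀ t ∈ Icc (0 : ℝ) T, |β t| ≤ B := hB
  have hB0 : 0 ≤ B := (abs_nonneg _).trans (hB 0 (left_mem_Icc.2 h.coeff.pos.le))
  refine ⟨B + C, fun t ht => (hB t ht).trans (by linarith), fun c₁ c₂ θ s hc => ?_⟩
  let L := B + C + max |c₁| |c₂|
  have hcmax : 0 ≤ max |c₁| |c₂| := (abs_nonneg _).trans (le_max_left _ _)
  have hL : 0 ≤ L := by positivity
  obtain ⟨M, hM⟩ := isCompact_Icc.exists_bound_of_continuousOn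
    (h.q_cont.continuousOn (s := Icc (-L) L))
  obtain ⟨N, hN⟩ := isCompact_Icc.exists_bound_of_continuousOn
    (h.F_cont.continuousOn (s := Icc (-L) L))
  obtain ⟨K, hK⟩ := h.F_lip L
  have hQc : Continuous fun x => q (clampTo L x) := h.q_cont.comp (continuous_clampTo L)
  have hGc : Continuous fun x => F (clampTo L x) := h.F_cont.comp (continuous_clampTo L)
  obtain ⟨c, hcm, σ, u, y, hu, hle, htouch, hceq⟩ := exists_lienardSol_touching h.coeff h.ψ_cont
    h.ψ_mono h.ψ_zero hQc hGc (fun x => hM _ (clampTo_mem hL x)) (fun x => hN _ (clampTo_mem hL x))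
    hβc hc θ s
  have hβL : ∀ t ∈ Icc (0 : ℝ) T, clampTo L (β t) = β t := fun t ht =>
    clampTo_eq_self ((hB t ht).trans (by simp only [L]; linarith))
  refine ⟨c, hcm, σ, u, hle, htouch, hceq, fun hc0 => ?_, fun hσS => ?_⟩
  · refine hu.level_le_of_touching (K := |K|) h.coeff h.ψ_mono hQc (fun x x' => ?_)
      (hβ.congr (fun t ht => by rw [hβL t ht]) fun t ht => by rw [hβL t ht])
      (fun t ht => by simpa [hc0] using hle t ht) (by simpa [hc0] using htouch)
    refine (hK _ (clampTo_mem hL x) _ (clampTo_mem hL x')).trans ?_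
    exact mul_le_mul (le_abs_self K) (abs_clampTo_sub_le L x x') (abs_nonneg _) (abs_nonneg _)
  · obtain ⟨t₁, ht₁, htt⟩ := htouch
    have hbd : ∀ t ∈ Icc (0 : ℝ) T, |u t - c| ≤ B + C := by
      intro t ht
      have h1 := hC _ _ σ u y hQc hGc (fun x => h.q_ge _) hσS hu t ht t₁ ht₁
      have h2 := hB t₁ ht₁
      rw [abs_le] at h1 h2 ⊢
      constructor <;> linarith [h1.1, h1.2, h2.1, h2.2]
    have huL : ∀ t ∈ Icc (0 : ℝ) T, clampTo L (u t) = u t := fun t ht => by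
      have h1 := hbd t ht
      have h2 : |c| ≤ max |c₁| |c₂| := abs_le_max_abs_abs hcm.1 hcm.2
      refine clampTo_eq_self ?_
      rw [abs_le] at h1 h2 ⊢
      constructor <;> simp only [L] <;> linarith [h1.1, h1.2, h2.1, h2.2]
    exact ⟨hbd, y, hu.congr (fun t ht => by rw [huL t ht]) fun t ht => by rw [huL t ht]⟩

/-- Below the level of an upper solution there is a solution. -/
theorem exists_sol_level_le (h : LienardData T ψ a e q F A E m) {σβ : ℝ} {β z : ℝ → ℝ}
    (hβ : IsUpperSol T ψ a e q F σβ β z) :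
    ∃ σ ≤ σβ, ∃ u y, IsLienardSol T ψ a e q F σ u y := by
  obtain ⟨D, -, hD⟩ := h.exists_sol_touching hβ σβ
  obtain ⟨c, hc, σ, u, -, -, -, h0, h1⟩ := hD 0 0 0 0 le_rfl
  have hσ := h0 (le_antisymm hc.2 hc.1)
  obtain ⟨-, y, hy⟩ := h1 hσ
  exact ⟨σ, hσ, u, y, hy⟩

/-- A solution at level `s` strictly below an upper solution of smaller level. -/
theorem exists_sol_below (h : LienardData T ψ a e q F A E m) {σβ s k R₁ abar : ℝ} {β z : ℝ → ℝ}
    (habar : ∫ t in (0 : ℝ)..T, a t = abar * T) (hβ : IsUpperSol T ψ a e q F σβ β z)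
    (hs : σβ < s) (hk : s < abar * k) (hq : ∀ x ≤ -R₁, k ≤ q x) :
    ∃ u y, IsLienardSol T ψ a e q F s u y ∧ ∀ t ∈ Icc (0 : ℝ) T, u t < β t := by
  obtain ⟨D, hDβ, hD⟩ := h.exists_sol_touching hβ s
  have hD0 : 0 ≤ D := (abs_nonneg _).trans (hDβ 0 (left_mem_Icc.2 h.coeff.pos.le))
  obtain ⟨R, hR⟩ : ∃ R, R = D + |R₁| + 1 := ⟨_, rfl⟩
  have hRpos : 0 < R := by rw [hR]; positivity
  obtain ⟨c, hc, σ, u, hle, -, hceq, h0, h1⟩ := hD (-R) 0 1 s (by linarith)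
  rw [one_mul] at hceq
  have hc0 : c < 0 := by
    refine lt_of_le_of_ne hc.2 fun h2 => ?_
    have h3 := h0 h2
    rw [h2, min_eq_right (by linarith)] at hceq
    rcases max_choice (-R) (0 + (σ - s)) with h4 | h4 <;> rw [h4] at hceq <;> linarith
  have hσ : σ = s := by
    rcases le_or_gt (c + (σ - s)) (-R) with h2 | h2
    · exfalso
      rw [min_eq_right (by linarith), max_eq_left h2] at hceq
      have hσs : σ ≤ s := by linarith
      obtain ⟨h3, y, hy⟩ := h1 hσs
      have := h.mul_le_level habar hy fun t ht => hq (u t) (by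
        have := (abs_le.1 (h3 t ht)).2
        linarith [le_abs_self R₁])
      linarith
    · rcases le_total (c + (σ - s)) 0 with h3 | h3
      · rw [min_eq_right h3, max_eq_right h2.le] at hceq
        linarith
      · rw [min_eq_left h3, max_eq_right (by linarith)] at hceq
        linarith
  subst hσ
  obtain ⟨-, y, hy⟩ := h1 le_rfl
  exact ⟨u, y, hy, fun t ht => (hle t ht).trans_lt (by linarith)⟩

/-- A solution at level `s` that exceeds somewhere an upper solution of smaller level. -/
theorem exists_sol_not_below (h : LienardData T ψ a e q F A E m) {σβ s k R₁ abar : ℝ}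
    {β z : ℝ → ℝ} (habar : ∫ t in (0 : ℝ)..T, a t = abar * T)
    (hβ : IsUpperSol T ψ a e q F σβ β z)
    (hs : σβ < s) (hk : s < abar * k) (hq : ∀ x ≥ R₁, k ≤ q x) :
    ∃ u y, IsLienardSol T ψ a e q F s u y ∧ ∃ t ∈ Icc (0 : ℝ) T, β t < u t := by
  obtain ⟨D, hDβ, hD⟩ := h.exists_sol_touching hβ s
  have hD0 : 0 ≤ D := (abs_nonneg _).trans (hDβ 0 (left_mem_Icc.2 h.coeff.pos.le))
  obtain ⟨R, hR⟩ : ∃ R, R = D + |R₁| + 1 := ⟨_, rfl⟩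
  have hRpos : 0 < R := by rw [hR]; positivity
  obtain ⟨c, hc, σ, u, -, htouch, hceq, h0, h1⟩ := hD 0 R (-1) s (by linarith)
  have hc0 : 0 < c := by
    refine lt_of_le_of_ne hc.1 fun h2 => ?_
    have h3 := h0 h2.symm
    have h4 : 0 < min R (c + -1 * (σ - s)) := lt_min hRpos (by linarith)
    exact absurd (h4.trans_le (le_max_right _ _)) (by rw [← hceq, ← h2]; simp)
  rw [max_eq_right] at hceq
  swap
  · by_contra! h2
    rw [max_eq_left h2.le] at hceq
    linarith
  have hσ : σ = s := by
    rcases le_or_gt R (c + -1 * (σ - s)) with h2 | h2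
    · exfalso
      rw [min_eq_left h2] at hceq
      have hσs : σ ≤ s := by linarith
      obtain ⟨h3, y, hy⟩ := h1 hσs
      have := h.mul_le_level habar hy fun t ht => hq (u t) (by
        have := (abs_le.1 (h3 t ht)).1
        linarith [le_abs_self R₁])
      linarith
    · rw [min_eq_right h2.le] at hceq
      linarith
  subst hσ
  obtain ⟨-, y, hy⟩ := h1 le_rfl
  obtain ⟨t, ht, htt⟩ := htouch
  exact ⟨u, y, hy, t, ht, by linarith⟩

end LienardData

/-- If some solution has level at most `S < abar k`, where `q ≥ k` near infinity, then there is a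
solution of minimal level. -/
theorem LienardData.exists_min_level {T A E m : ℝ} {ψ a e q F : ℝ → ℝ}
    (h : LienardData T ψ a e q F A E m) {S k R₁ abar : ℝ}
    (habar : ∫ t in (0 : ℝ)..T, a t = abar * T) (hS : S < abar * k)
    (hq : ∀ x, R₁ ≤ |x| → k ≤ q x)
    (hne : ∃ σ ≤ S, ∃ u y, IsLienardSol T ψ a e q F σ u y) :
    ∃ s₀ ≤ S, (∃ u y, IsLienardSol T ψ a e q F s₀ u y) ∧
      ∀ σ u y, IsLienardSol T ψ a e q F σ u y → s₀ ≤ σ := by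
  have hT := h.coeff.pos
  have m0 : (0 : ℝ) ∈ Icc 0 T := left_mem_Icc.2 hT.le
  have mT : T ∈ Icc 0 T := right_mem_Icc.2 hT.le
  obtain ⟨C, hC0, hC⟩ := h.exists_oscillation_bound S
  obtain ⟨L, hLdef⟩ : ∃ L, L = |R₁| + C := ⟨_, rfl⟩
  have hL : 0 ≤ L := by rw [hLdef]; positivity
  have hbound : ∀ σ u y, σ ≤ S → IsLienardSol T ψ a e q F σ u y → ∀ t ∈ Icc (0 : ℝ) T,
      |u t| ≤ L := by
    intro σ u y hσ hu t ht
    obtain ⟨t₁, ht₁, hlt⟩ : ∃ t₁ ∈ Icc (0 : ℝ) T, |u t₁| < R₁ := by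
      by_contra! hcon
      have := h.mul_le_level habar hu fun t ht => hq _ (hcon t ht)
      linarith
    have h1 := hC q F σ u y h.q_cont h.F_cont h.q_ge hσ hu t ht t₁ ht₁
    have h2 := le_abs_self R₁
    rw [abs_le] at h1 ⊢
    rw [abs_lt] at hlt
    constructor <;> linarith [h1.1, h1.2, hlt.1, hlt.2]
  obtain ⟨M, hM⟩ := isCompact_Icc.exists_bound_of_continuousOn
    (h.q_cont.continuousOn (s := Icc (-L) L))
  obtain ⟨N, hN⟩ := isCompact_Icc.exists_bound_of_continuousOn
    (h.F_cont.continuousOn (s := Icc (-L) L))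
  have hQc : Continuous fun x => q (clampTo L x) := h.q_cont.comp (continuous_clampTo L)
  have hGc : Continuous fun x => F (clampTo L x) := h.F_cont.comp (continuous_clampTo L)
  obtain ⟨lev, V, Y, Λ, hY0, hlevc, hVc, hV0, hVlip, hVpos, hVneg, hVsol, hVsol'⟩ :=
    exists_poincareOperator h.coeff h.ψ_cont h.ψ_mono h.ψ_zero hQc hGc
      (fun x => hM _ (clampTo_mem hL x)) (fun x => hN _ (clampTo_mem hL x))
  let bot : Icc (0 : ℝ) T := ⟨0, m0⟩
  let top : Icc (0 : ℝ) T := ⟨T, mT⟩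
  let Z : Set (C(Icc (0 : ℝ) T, ℝ) × ℝ) := (lipschitzBall T Λ L ×ˢ Icc (-Y) Y) ∩
    ({p | p.1 = ContinuousMap.const _ (p.1 bot) + V p} ∩ ({p | V p top = 0} ∩ {p | lev p.1 ≤ S}))
  have hev : ∀ t, Continuous fun u : C(Icc (0 : ℝ) T, ℝ) => u t := fun t =>
    continuous_eval_const t
  have hZ : IsCompact Z := by
    refine ((isCompact_lipschitzBall T Λ L).prod isCompact_Icc).inter_right
      (IsClosed.inter ?_ (IsClosed.inter ?_ ?_))
    · exact isClosed_eq continuous_fst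
        ((ContinuousMap.continuous_const'.comp ((hev bot).comp continuous_fst)).add hVc)
    · exact isClosed_eq ((hev top).comp hVc) continuous_const
    · exact isClosed_le (hlevc.comp continuous_fst) continuous_const
  have hmemZ : ∀ σ v y, σ ≤ S → IsLienardSol T ψ a e q F σ v y →
      ∃ p ∈ Z, lev p.1 = σ := by
    intro σ v y hσ hv
    have hvL := hbound σ v y hσ hv
    have hv' := hv.congr (Q' := fun x => q (clampTo L x)) (G' := fun x => F (clampTo L x))
      (fun t ht => by rw [clampTo_eq_self (hvL t ht)])
      (fun t ht => by rw [clampTo_eq_self (hvL t ht)])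
    let u : C(Icc (0 : ℝ) T, ℝ) := ⟨fun t => v t, hv.continuousOn.domRestrict⟩
    obtain ⟨h1, h2, h3⟩ := hVsol' u v y σ (fun t => rfl) hv'
    have hy : |y 0| ≤ Y := by
      rw [abs_le]
      constructor
      · by_contra! hcon
        exact (hVneg (u, y 0) hcon.le).ne h3
      · by_contra! hcon
        exact (hVpos (u, y 0) hcon.le).ne' h3
    refine ⟨(u, y 0), ⟨⟨⟨fun t => hvL t t.2, fun t t' => ?_⟩, abs_le.1 hy⟩, ?_, h3, ?_⟩, h1⟩
    · simp only
      rw [h2 t, h2 t', add_sub_add_left_eq_sub]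
      exact hVlip (u, y 0) hy t t'
    · ext t
      exact h2 t
    · exact h1.trans_le hσ
  obtain ⟨σ₁, hσ₁, u₁, y₁, hu₁⟩ := hne
  obtain ⟨p₁, hp₁, -⟩ := hmemZ σ₁ u₁ y₁ hσ₁ hu₁
  obtain ⟨⟨u, y₀⟩, hp, hmin⟩ := hZ.exists_isMinOn ⟨p₁, hp₁⟩
    (hlevc.comp continuous_fst).continuousOn
  obtain ⟨⟨⟨huL, -⟩, -⟩, hfix, hVT, hlevS⟩ := hp
  refine ⟨lev u, hlevS, ?_, fun σ v y hv => ?_⟩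
  · obtain ⟨y, hy⟩ := hVsol u y₀ (u bot) (fun t => DFunLike.congr_fun hfix t) hVT
    have hext : ∀ t ∈ Icc (0 : ℝ) T, clampTo L (IccExtend hT.le u t) = IccExtend hT.le u t :=
      fun t ht => clampTo_eq_self (by rw [IccExtend_of_mem _ _ ht]; exact huL _)
    exact ⟨_, y, hy.congr (fun t ht => by rw [hext t ht]) fun t ht => by rw [hext t ht]⟩
  · rcases le_or_gt σ S with hσ | hσ
    · obtain ⟨p, hp, rfl⟩ := hmemZ σ v y hσ hv
      exact hmin hp
    · exact hlevS.trans hσ.le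

theorem IsSolWE.congr_ae {T s : ℝ} {φ f q a e a' e' u : ℝ → ℝ} (ha : a =ᵐ[muT T] a')
    (he : e =ᵐ[muT T] e') (h : IsSolWE T φ f q a e s u) : IsSolWE T φ f q a' e' s u := by
  obtain ⟨u', w, h1, h2, h3⟩ := h
  refine ⟨u', w, h1, h2, ?_⟩
  filter_upwards [h3, ha, he] with t h4 h5 h6
  rw [← h5, ← h6, h4]

theorem primitive_comp_eq {T : ℝ} {f u u' : ℝ → ℝ} (hf : Continuous f)
    (hu : ∀ t ∈ Icc (0 : ℝ) T, HasDerivWithinAt u (u' t) (Icc (0 : ℝ) T) t)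
    (hu' : ContinuousOn u' (Icc 0 T)) {t : ℝ} (ht : t ∈ Icc 0 T) :
    IntervalIntegrable (fun τ => f (u τ) * u' τ) volume 0 t ∧
    ∫ τ in (0 : ℝ)..t, f (u τ) * u' τ =
      (∫ τ in (0 : ℝ)..u t, f τ) - ∫ τ in (0 : ℝ)..u 0, f τ := by
  have hsub : Icc 0 t ⊆ Icc 0 T := Icc_subset_Icc_right ht.2
  have huc : ContinuousOn u (Icc 0 T) := fun t ht => (hu t ht).continuousWithinAt
  have hintg : IntervalIntegrable (fun τ => f (u τ) * u' τ) volume 0 t := by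
    refine ContinuousOn.intervalIntegrable ?_
    rw [uIcc_of_le ht.1]
    exact ((hf.comp_continuousOn huc).mul hu').mono hsub
  refine ⟨hintg, intervalIntegral.integral_eq_sub_of_hasDeriv_right_of_le
    (f := fun x => ∫ τ in (0 : ℝ)..u x, f τ) ht.1
    (fun x hx => ((hu x (hsub hx)).comp_primitive hf).continuousWithinAt.mono hsub)
    (fun x hx => ?_) hintg⟩
  have hx' : x ∈ Icc 0 T := hsub (Ioo_subset_Icc_self hx)
  exact (((hu x hx').comp_primitive hf).hasDerivAt
    (Icc_mem_nhds hx.1 (hx.2.trans_le ht.2))).hasDerivWithinAt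

/-- The scalar equation is equivalent to a planar system. -/
theorem isSolWE_iff {T A E s : ℝ} {φ ψ f q a e u : ℝ → ℝ} (hD : BoundedCoeff T a e A E)
    (hψ : Continuous ψ) (hφψ : ∀ x, φ (ψ x) = x) (hψφ : ∀ x, ψ (φ x) = x)
    (hf : Continuous f) (hq : Continuous q) :
    IsSolWE T φ f q a e s u ↔
      ∃ y, IsLienardSol T ψ a e q (fun x => ∫ τ in (0 : ℝ)..x, f τ) s u y := by
  have hT := hD.pos
  have m0 : (0 : ℝ) ∈ Icc 0 T := left_mem_Icc.2 hT.le
  have mT : T ∈ Icc 0 T := right_mem_Icc.2 hT.le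
  constructor
  · rintro ⟨u', w, ⟨hu, hu'c, hper, hper'⟩, ⟨hwint, hw⟩, heq⟩
    have huc : ContinuousOn u (Icc 0 T) := fun t ht => (hu t ht).continuousWithinAt
    have hqc : ContinuousOn (fun τ => q (u τ)) (Icc 0 T) := hq.comp_continuousOn huc
    refine ⟨fun t => φ (u' t) + ∫ τ in (0 : ℝ)..u t, f τ, fun t ht => ?_, fun t ht => ?_, hper, ?_⟩
    · rw [add_sub_cancel_right, hψφ]
      exact hu t ht
    · obtain ⟨hintg, hFTC⟩ := primitive_comp_eq hf hu hu'c ht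
      have hwt : IntervalIntegrable w volume 0 t := by
        rw [intervalIntegrable_iff_integrableOn_Icc_of_le ht.1]
        exact hwint.mono_set (Icc_subset_Icc_right ht.2)
      have h1 : ∫ τ in (0 : ℝ)..t, (s + e τ - a τ * q (u τ)) =
          ∫ τ in (0 : ℝ)..t, (w τ + f (u τ) * u' τ) := by
        refine intervalIntegral.integral_congr_ae ?_
        have h2 := (ae_restrict_iff' measurableSet_Icc).1 heq
        filter_upwards [h2] with τ hτ hmem
        rw [uIoc_of_le ht.1] at hmem
        linarith [hτ ⟨hmem.1.le, hmem.2.trans ht.2⟩]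
      rw [h1, intervalIntegral.integral_add hwt hintg, hFTC, hw t ht]
      ring
    · simp only [hper, hper']
  · rintro ⟨y, h⟩
    have huc := h.continuousOn
    have hyc := h.continuousOn_y hD hq
    have hFc : Continuous fun x => ∫ τ in (0 : ℝ)..x, f τ :=
      intervalIntegral.continuous_primitive (fun _ _ => hf.intervalIntegrable _ _) 0
    have hqc : ContinuousOn (fun τ => q (u τ)) (Icc 0 T) := hq.comp_continuousOn huc
    let u' : ℝ → ℝ := fun t => ψ (y t - ∫ τ in (0 : ℝ)..u t, f τ)
    have hu'c : ContinuousOn u' (Icc 0 T) :=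
      hψ.comp_continuousOn (hyc.sub (hFc.comp_continuousOn huc))
    refine ⟨u', fun t => (s + e t - a t * q (u t)) - f (u t) * u' t,
      ⟨h.hasDeriv, hu'c, h.u_per, ?_⟩, ⟨?_, fun t ht => ?_⟩, ?_⟩
    · simp only [u', h.u_per, h.y_per]
    · rw [← intervalIntegrable_iff_integrableOn_Icc_of_le hT.le]
      exact (hD.intervalIntegrable_rhs s hqc m0 mT).sub
        (primitive_comp_eq hf h.hasDeriv hu'c mT).1
    · obtain ⟨hintg, hFTC⟩ := primitive_comp_eq hf h.hasDeriv hu'c ht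
      rw [intervalIntegral.integral_sub (hD.intervalIntegrable_rhs s hqc m0 ht) hintg, hFTC]
      simp only [u', hφψ]
      rw [h.y_eq t ht]
      ring
    · exact ae_of_all _ fun t => by ring

theorem EReal.coe_lt_coe_mul_iff {c s : ℝ} (hc : 0 < c) (ω : EReal) :
    (s : EReal) < (c : EReal) * ω ↔ ((s / c : ℝ) : EReal) < ω := by
  induction ω with
  | bot => simp [EReal.coe_mul_bot_of_pos hc]
  | top => simp [EReal.coe_mul_top_of_pos hc]
  | coe w =>
    rw [← EReal.coe_mul, EReal.coe_lt_coe_iff, EReal.coe_lt_coe_iff, div_lt_iff₀ hc, mul_comm]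

theorem isUpperSol_const {T A E L : ℝ} {ψ a e q F : ℝ → ℝ} (hD : BoundedCoeff T a e A E)
    (hψ0 : ψ 0 = 0) {u₀ : ℝ} (hq : 0 ≤ q u₀) (he : ∀ t, -L ≤ e t) :
    IsUpperSol T ψ a e q F (A * q u₀ + L) (fun _ => u₀) (fun _ => F u₀) := by
  refine ⟨fun t _ => ?_, fun t _ t' _ htt => ?_, rfl, rfl⟩
  · rw [sub_self, hψ0]
    exact hasDerivWithinAt_const _ _ _
  · rw [sub_self]
    refine intervalIntegral.integral_nonneg htt fun τ _ => ?_
    have := mul_le_mul_of_nonneg_right (hD.a_le τ) hq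
    linarith [he τ]

theorem exists_lipschitz_primitive {f : ℝ → ℝ} (hf : Continuous f) (L : ℝ) :
    ∃ K, ∀ x ∈ Icc (-L) L, ∀ x' ∈ Icc (-L) L,
      |(∫ τ in (0 : ℝ)..x, f τ) - ∫ τ in (0 : ℝ)..x', f τ| ≤ K * |x - x'| := by
  obtain ⟨K, hK⟩ := isCompact_Icc.exists_bound_of_continuousOn (hf.continuousOn (s := Icc (-L) L))
  refine ⟨K, fun x hx x' hx' => ?_⟩
  rw [intervalIntegral.integral_interval_sub_left (hf.intervalIntegrable _ _)
    (hf.intervalIntegrable _ _), ← Real.norm_eq_abs]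
  exact intervalIntegral.norm_integral_le_of_norm_le_const fun τ hτ =>
    hK τ (uIcc_subset_Icc hx' hx (uIoc_subset_uIcc hτ))

/-- Replacing the coefficients on a null set, one may assume that they are bounded everywhere. -/
theorem exists_boundedCoeff {T : ℝ} (hT : 0 < T) {a e : ℝ → ℝ}
    (ha_meas : Measurable a) (ha_bdd : ∃ C : ℝ, ∀ᵐ t ∂(muT T), |a t| ≤ C)
    (ha_nonneg : ∀ᵐ t ∂(muT T), 0 ≤ a t)
    (he_meas : Measurable e) (he_bdd : ∃ C : ℝ, ∀ᵐ t ∂(muT T), |e t| ≤ C)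
    (he_mean : (1 / T) * ∫ t in Icc (0:ℝ) T, e t = 0) :
    ∃ (a' e' : ℝ → ℝ) (E : ℝ), BoundedCoeff T a' e' (essSup (fun t => |a t|) (muT T)) E ∧
      a =ᵐ[muT T] a' ∧ e =ᵐ[muT T] e' ∧
      (∀ t, -essSup (fun t => max (-(e t)) 0) (muT T) ≤ e' t) := by
  obtain ⟨Ca, hCa⟩ := ha_bdd
  obtain ⟨Ce, hCe⟩ := he_bdd
  have hA : ∀ᵐ t ∂(muT T), |a t| ≤ essSup (fun t => |a t|) (muT T) :=
    ae_le_essSup (isBoundedUnder_of_eventually_le hCa)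
  have hL : ∀ᵐ t ∂(muT T), max (-(e t)) 0 ≤ essSup (fun t => max (-(e t)) 0) (muT T) := by
    refine ae_le_essSup (isBoundedUnder_of_eventually_le (a := Ce) ?_)
    filter_upwards [hCe] with t ht
    exact max_le ((neg_le_abs _).trans ht) ((abs_nonneg _).trans ht)
  generalize essSup (fun t => |a t|) (muT T) = A at *
  generalize essSup (fun t => max (-(e t)) 0) (muT T) = L at *
  have : (ae (muT T)).NeBot := by
    rw [ae_neBot, muT, Ne, Measure.restrict_eq_zero, Real.volume_Icc, sub_zero]
    simpa using hT
  have hA0 : 0 ≤ A := by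
    obtain ⟨t, ht⟩ := hA.exists
    exact (abs_nonneg _).trans ht
  have hae : a =ᵐ[muT T] fun t => max 0 (min A (a t)) := by
    filter_upwards [hA, ha_nonneg] with t h1 h2
    rw [min_eq_right ((le_abs_self _).trans h1), max_eq_right h2]
  have hee : e =ᵐ[muT T] fun t => max (-L) (min Ce (e t)) := by
    filter_upwards [hL, hCe] with t h1 h2
    rw [min_eq_right ((le_abs_self _).trans h2), max_eq_right]
    linarith [(le_max_left _ _).trans h1]
  refine ⟨_, _, max |L| |Ce|, ⟨hT, measurable_const.max (measurable_const.min ha_meas),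
    measurable_const.max (measurable_const.min he_meas), fun t => le_max_left _ _,
    fun t => max_le hA0 (min_le_left _ _), fun t => ?_, ?_⟩, hae, hee, fun t => le_max_left _ _⟩
  · rw [abs_le]
    constructor
    · refine le_trans ?_ (le_max_left _ _)
      rw [neg_le_neg_iff]
      exact (le_abs_self L).trans (le_max_left _ _)
    · exact max_le ((neg_le_abs L).trans (le_max_left _ _))
        ((min_le_left _ _).trans ((le_abs_self Ce).trans (le_max_right _ _)))
  · rw [intervalIntegral.integral_of_le hT.le, ← integral_Icc_eq_integral_Ioc]
    refine (integral_congr_ae hee).symm.trans ?_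
    rcases mul_eq_zero.1 he_mean with h | h
    · exact absurd h (by positivity)
    · exact h

theorem eventually_le_of_tendsto_coe {q : ℝ → ℝ} {l : Filter ℝ} {ω : EReal} {c : ℝ}
    (hq : Tendsto (fun u : ℝ => ((q u : ℝ) : EReal)) l (nhds ω)) (hc : (c : EReal) < ω) :
    ∀ᶠ x in l, c ≤ q x := by
  filter_upwards [hq.eventually_const_lt hc] with x hx
  exact (EReal.coe_lt_coe_iff.1 hx).le

theorem exists_lower_bound_of_tendsto {q : ℝ → ℝ} (hq : Continuous q) {ωm ωp : EReal}
    (hq_bot : Tendsto (fun u : ℝ => ((q u : ℝ) : EReal)) atBot (nhds ωm))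
    (hq_top : Tendsto (fun u : ℝ => ((q u : ℝ) : EReal)) atTop (nhds ωp))
    (hωm : ωm ≠ ⊥) (hωp : ωp ≠ ⊥) : ∃ m, 0 ≤ m ∧ ∀ x, -m ≤ q x := by
  obtain ⟨k, -, hk⟩ := EReal.lt_iff_exists_real_btwn.1 (bot_lt_iff_ne_bot.2 hωm)
  obtain ⟨k', -, hk'⟩ := EReal.lt_iff_exists_real_btwn.1 (bot_lt_iff_ne_bot.2 hωp)
  obtain ⟨R, hR⟩ := eventually_atBot.1 (eventually_le_of_tendsto_coe hq_bot hk)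
  obtain ⟨R', hR'⟩ := eventually_atTop.1 (eventually_le_of_tendsto_coe hq_top hk')
  obtain ⟨M, hM⟩ := isCompact_Icc.exists_bound_of_continuousOn (hq.continuousOn (s := Icc R R'))
  refine ⟨|k| + |k'| + |M|, by positivity, fun x => ?_⟩
  have h1 := abs_nonneg k
  have h2 := abs_nonneg k'
  have h3 := abs_nonneg M
  rcases le_total x R with hx | hx
  · linarith [hR x hx, neg_abs_le k]
  · rcases le_total R' x with hx' | hx'
    · linarith [hR' x hx', neg_abs_le k']
    · linarith [(abs_le.1 (hM x ⟨hx, hx'⟩)).1, le_abs_self M]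

/-- Theorem for type-I nonlinearities with limits `ω₋, ω₊ ∈ (−∞,+∞]` (as extended reals):
if `0 ≤ q(u₀) < min{ω₋,ω₊}` and `ā·min{ω₋,ω₊} > ‖a‖_∞ q(u₀) + ‖e⁻‖_∞`, then there is
`s₀ < ā·ω₋` realizing the zero/one/two alternative described below. -/
theorem statement14
    (T : ℝ) (hT : 0 < T)
    (φ f q a e : ℝ → ℝ)
    (hφmono : StrictMono φ) (hφcont : Continuous φ)
    (hφsurj : Function.Surjective φ) (hφ0 : φ 0 = 0)
    (hf : Continuous f) (hq : Continuous q)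
    (ha_meas : Measurable a) (ha_bdd : ∃ C : ℝ, ∀ᵐ t ∂(muT T), |a t| ≤ C)
    (ha_nonneg : ∀ᵐ t ∂(muT T), 0 ≤ a t)
    (abar : ℝ) (habar_def : (1 / T) * ∫ t in Icc (0:ℝ) T, a t = abar)
    (habar_pos : 0 < abar)
    (he_meas : Measurable e) (he_bdd : ∃ C : ℝ, ∀ᵐ t ∂(muT T), |e t| ≤ C)
    (he_mean : (1 / T) * ∫ t in Icc (0:ℝ) T, e t = 0)
    (ωm ωp : EReal)
    (hq_bot : Tendsto (fun u : ℝ => ((q u : ℝ) : EReal)) atBot (nhds ωm))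
    (hq_top : Tendsto (fun u : ℝ => ((q u : ℝ) : EReal)) atTop (nhds ωp))
    (hωm : ωm ≠ ⊥) (hωp : ωp ≠ ⊥)
    (u₀ : ℝ) (hqu₀ : 0 ≤ q u₀) (hqu₀lt : ((q u₀ : ℝ) : EReal) < min ωm ωp)
    (hnorm : ((essSup (fun t => |a t|) (muT T) * q u₀ +
        essSup (fun t => max (-(e t)) 0) (muT T) : ℝ) : EReal) <
      (abar : EReal) * min ωm ωp) :
    ∃ s₀ : ℝ, ((s₀ : ℝ) : EReal) < (abar : EReal) * ωm ∧
      (∀ s : ℝ, s < s₀ → ¬∃ u : ℝ → ℝ, IsSolWE T φ f q a e s u) ∧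
      (∃ u : ℝ → ℝ, IsSolWE T φ f q a e s₀ u) ∧
      (∀ s : ℝ, s₀ < s → ((s : ℝ) : EReal) < (abar : EReal) * ωm →
        ∃ u : ℝ → ℝ, IsSolWE T φ f q a e s u) ∧
      (∀ s : ℝ, s₀ < s → ((s : ℝ) : EReal) < (abar : EReal) * min ωm ωp →
        ∃ u₁ u₂ : ℝ → ℝ, IsSolWE T φ f q a e s u₁ ∧ IsSolWE T φ f q a e s u₂ ∧
          ∃ t ∈ Icc (0:ℝ) T, u₁ t ≠ u₂ t) := by
  obtain ⟨a', e', E, hD, haa, hee, heL⟩ :=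
    exists_boundedCoeff hT ha_meas ha_bdd ha_nonneg he_meas he_bdd he_mean
  obtain ⟨m, hm, hqm⟩ := exists_lower_bound_of_tendsto hq hq_bot hq_top hωm hωp
  generalize essSup (fun t => |a t|) (muT T) = A at *
  generalize essSup (fun t => max (-(e t)) 0) (muT T) = L at *
  let ψ := (hφmono.orderIsoOfSurjective φ hφsurj).symm
  have hφψ : ∀ x, φ (ψ x) = x := (hφmono.orderIsoOfSurjective φ hφsurj).apply_symm_apply
  have hψφ : ∀ x, ψ (φ x) = x := (hφmono.orderIsoOfSurjective φ hφsurj).symm_apply_apply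
  have hψ0 : ψ 0 = 0 := by rw [← hφ0, hψφ, hφ0]
  have hdata : LienardData T ψ a' e' q (fun x => ∫ τ in (0 : ℝ)..x, f τ) A E m :=
    { coeff := hD
      ψ_cont := ψ.continuous
      ψ_mono := ψ.strictMono
      ψ_zero := hψ0
      q_cont := hq
      F_cont := intervalIntegral.continuous_primitive (fun _ _ => hf.intervalIntegrable _ _) 0
      F_lip := exists_lipschitz_primitive hf
      m_nonneg := hm
      q_ge := hqm }
  have habar : ∫ t in (0 : ℝ)..T, a' t = abar * T := by
    rw [intervalIntegral.integral_of_le hT.le, ← integral_Icc_eq_integral_Ioc]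
    refine (integral_congr_ae haa).symm.trans ?_
    rw [← habar_def]
    change ∫ t in Icc (0 : ℝ) T, a t = _
    field_simp
  have hiff : ∀ s u, IsSolWE T φ f q a e s u ↔
      ∃ y, IsLienardSol T ψ a' e' q (fun x => ∫ τ in (0 : ℝ)..x, f τ) s u y := fun s u =>
    ⟨fun h => (isSolWE_iff hD ψ.continuous hφψ hψφ hf hq).1 (h.congr_ae haa hee),
      fun h => ((isSolWE_iff hD ψ.continuous hφψ hψφ hf hq).2 h).congr_ae haa.symm hee.symm⟩
  have hlim : ∀ (s : ℝ) (ω : EReal), (s : EReal) < (abar : EReal) * ω →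
      ∃ k : ℝ, s < abar * k ∧ (k : EReal) < ω := by
    intro s ω h
    obtain ⟨k, h1, h2⟩ := EReal.lt_iff_exists_real_btwn.1
      ((EReal.coe_lt_coe_mul_iff habar_pos ω).1 h)
    rw [EReal.coe_lt_coe_iff, div_lt_iff₀ habar_pos, mul_comm] at h1
    exact ⟨k, h1, h2⟩
  have hbelow : ∀ k : ℝ, (k : EReal) < ωm → ∃ R, ∀ x ≤ -R, k ≤ q x := by
    intro k hk
    obtain ⟨R, hR⟩ := eventually_atBot.1 (eventually_le_of_tendsto_coe hq_bot hk)
    exact ⟨-R, fun x hx => hR x (by linarith)⟩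
  have habove : ∀ k : ℝ, (k : EReal) < ωp → ∃ R, ∀ x ≥ R, k ≤ q x := fun k hk =>
    eventually_atTop.1 (eventually_le_of_tendsto_coe hq_top hk)
  obtain ⟨s₀, hs₀, ⟨β, z, hβ⟩, hmin⟩ :
      ∃ s₀ ≤ A * q u₀ + L, (∃ u y, IsLienardSol T ψ a' e' q
        (fun x => ∫ τ in (0 : ℝ)..x, f τ) s₀ u y) ∧
      ∀ σ u y, IsLienardSol T ψ a' e' q (fun x => ∫ τ in (0 : ℝ)..x, f τ) σ u y → s₀ ≤ σ := by
    obtain ⟨k, hk, hkω⟩ := hlim _ _ hnorm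
    obtain ⟨R, hR⟩ := hbelow k (hkω.trans_le (min_le_left _ _))
    obtain ⟨R', hR'⟩ := habove k (hkω.trans_le (min_le_right _ _))
    refine hdata.exists_min_level (R₁ := max R R') habar hk (fun x hx => ?_)
      (hdata.exists_sol_level_le (isUpperSol_const hD hψ0 hqu₀ heL))
    rcases le_abs.1 hx with h | h
    · exact hR' x ((le_max_right _ _).trans h)
    · exact hR x (by linarith [(le_max_left R R').trans h])
  have hup := hβ.isUpperSol hD hq
  refine ⟨s₀, ?_, fun s hs => ?_, ⟨β, (hiff _ _).2 ⟨z, hβ⟩⟩, fun s hs hsω => ?_,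
    fun s hs hsω => ?_⟩
  · obtain ⟨k, hk, hkω⟩ := hlim _ _ hnorm
    rw [EReal.coe_lt_coe_mul_iff habar_pos]
    refine lt_trans ?_ (hkω.trans_le (min_le_left _ _))
    rw [EReal.coe_lt_coe_iff, div_lt_iff₀ habar_pos]
    linarith
  · rintro ⟨u, hu⟩
    obtain ⟨y, hy⟩ := (hiff _ _).1 hu
    exact absurd (hmin s u y hy) (not_le.2 hs)
  · obtain ⟨k, hk, hkω⟩ := hlim _ _ hsω
    obtain ⟨R, hR⟩ := hbelow k hkω
    obtain ⟨u, y, hu, -⟩ := hdata.exists_sol_below habar hup hs hk hR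
    exact ⟨u, (hiff _ _).2 ⟨y, hu⟩⟩
  · obtain ⟨k, hk, hkω⟩ := hlim _ _ hsω
    obtain ⟨R, hR⟩ := hbelow k (hkω.trans_le (min_le_left _ _))
    obtain ⟨R', hR'⟩ := habove k (hkω.trans_le (min_le_right _ _))
    obtain ⟨u₁, y₁, hu₁, hlt₁⟩ := hdata.exists_sol_below habar hup hs hk hR
    obtain ⟨u₂, y₂, hu₂, t, ht, hlt₂⟩ := hdata.exists_sol_not_below habar hup hs hk hR'
    exact ⟨u₁, u₂, (hiff _ _).2 ⟨y₁, hu₁⟩, (hiff _ _).2 ⟨y₂, hu₂⟩, t, ht,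
      ((hlt₁ t ht).trans hlt₂).ne⟩
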